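/- arXiv:2103.04410 — 3 statements merged into one kernel-verified Lean document; each statement's English description precedes it below -/
import Mathlib

section
/- Theorem 1, case σ > 0, distance bound: Suppose Assumptions 1, 2 and 4 hold with parameter σ > 0, and run the OptDE algorithm with this σ for K ≥ 1 iterations. Then the returned best iterate w̃_K satisfies ‖w̃_K − w*‖ ≤ (C_0/σ) ‖w_0 − w*‖ √(L / (A_{K−1} + a_1)), where C_0 = (1 + δ/(αγ)) √(8α/γ), a_1 = αγ/L, A_{K−1} = (1/σ)((1 + αγσ/L)^{K−1} − 1), and w* is the σ-weak solution from Assumption 4. -/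
open scoped RealInnerProductSpace
open Finset MeasureTheory

/-- `Vec d` is the ambient space `ℝ^d` with its standard inner product. -/
abbrev Vec (d : ℕ) := EuclideanSpace ℝ (Fin d)

/-- The dual norm `‖y‖_* = sup_{nrm x ≤ 1} ⟪x, y⟫` of a (general) norm `nrm` on `ℝ^d`. -/
noncomputable def dualNorm {d : ℕ} (nrm : Vec d → ℝ) (y : Vec d) : ℝ :=
  sSup ((fun x => (⟪x, y⟫ : ℝ)) '' {x | nrm x ≤ 1})

/-- The Bregman divergence `V_v(w) = ½‖w‖² − ½‖v‖² − ⟪∇½‖v‖², w − v⟫` of `½ nrm²`,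
where `g` is the gradient map of `½ nrm²`. -/
noncomputable def breg {d : ℕ} (nrm : Vec d → ℝ) (g : Vec d → Vec d) (v w : Vec d) : ℝ :=
  nrm w ^ 2 / 2 - nrm v ^ 2 / 2 - ⟪g v, w - v⟫

section aux
variable {d : ℕ}

lemma aux_cont (nrm : Vec d → ℝ) (g : Vec d → Vec d) (h0 : ∀ x, 0 ≤ nrm x)
    (hgrad : ∀ x : Vec d, HasGradientAt (fun v : Vec d => nrm v ^ 2 / 2) (g x) x) :
    Continuous nrm := by
  have h1 : Continuous (fun v : Vec d => nrm v ^ 2 / 2) :=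
    continuous_iff_continuousAt.2 fun x => (hgrad x).continuousAt
  have h2 : nrm = fun v => Real.sqrt (2 * (nrm v ^ 2 / 2)) := by
    funext v
    rw [mul_div_cancel₀ _ (by norm_num : (2:ℝ) ≠ 0), Real.sqrt_sq (h0 v)]
  rw [h2]
  fun_prop

lemma aux_lower (nrm : Vec d → ℝ) (hpos : ∀ x : Vec d, x ≠ 0 → 0 < nrm x)
    (hsm : ∀ (c : ℝ) (x : Vec d), nrm (c • x) = |c| * nrm x) (hc : Continuous nrm) :
    ∃ c > 0, ∀ x, c * ‖x‖ ≤ nrm x := by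
  have hz : nrm 0 = 0 := by simpa using hsm 0 0
  rcases (Metric.sphere (0 : Vec d) 1).eq_empty_or_nonempty with he | hne
  · refine ⟨1, one_pos, fun x => ?_⟩
    by_cases hx : x = 0
    · simp [hx, hz]
    · have : (‖x‖⁻¹ • x) ∈ Metric.sphere (0 : Vec d) 1 := by
        have hx' : ‖x‖ ≠ 0 := norm_ne_zero_iff.2 hx
        simp [norm_smul, hx']
      rw [he] at this
      exact this.elim
  · obtain ⟨m, hm, hmin⟩ := (isCompact_sphere (0 : Vec d) 1).exists_isMinOn hne hc.continuousOn
    have hm0 : m ≠ 0 := by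
      rintro rfl
      simp at hm
    refine ⟨nrm m, hpos m hm0, fun x => ?_⟩
    by_cases hx : x = 0
    · simp [hx, hz]
    · have hx' : ‖x‖ ≠ 0 := norm_ne_zero_iff.2 hx
      have : (‖x‖⁻¹ • x) ∈ Metric.sphere (0 : Vec d) 1 := by
        simp [norm_smul, hx']
      have h1 : nrm m ≤ nrm (‖x‖⁻¹ • x) := hmin this
      rw [hsm, abs_of_nonneg (by positivity)] at h1
      calc nrm m * ‖x‖ ≤ (‖x‖⁻¹ * nrm x) * ‖x‖ := by gcongr
        _ = nrm x := by field_simp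

lemma aux_dual (nrm : Vec d → ℝ) (hpos : ∀ x : Vec d, x ≠ 0 → 0 < nrm x)
    (hsm : ∀ (c : ℝ) (x : Vec d), nrm (c • x) = |c| * nrm x) (hc : Continuous nrm)
    (x y : Vec d) : (⟪y, x⟫ : ℝ) ≤ dualNorm nrm y * nrm x := by
  obtain ⟨c, hc0, hlow⟩ := aux_lower nrm hpos hsm hc
  by_cases hx : x = 0
  · have hz : nrm 0 = 0 := by simpa using hsm 0 0
    simp [hx, hz]
  have hp := hpos x hx
  have hb : BddAbove ((fun x => (⟪x, y⟫ : ℝ)) '' {x | nrm x ≤ 1}) := by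
    refine ⟨c⁻¹ * ‖y‖, ?_⟩
    rintro _ ⟨v, hv, rfl⟩
    have h1 : ‖v‖ ≤ c⁻¹ := by
      have h2 := hlow v
      have hv' : nrm v ≤ 1 := hv
      rw [← one_div, le_div_iff₀ hc0]
      linarith
    calc (⟪v, y⟫ : ℝ) ≤ ‖v‖ * ‖y‖ := real_inner_le_norm v y
      _ ≤ c⁻¹ * ‖y‖ := by gcongr
  have h3 : (⟪(nrm x)⁻¹ • x, y⟫ : ℝ) ≤ dualNorm nrm y := by
    refine le_csSup hb ⟨(nrm x)⁻¹ • x, ?_, rfl⟩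
    show nrm _ ≤ 1
    rw [hsm, abs_of_pos (by positivity), inv_mul_cancel₀ hp.ne']
  rw [real_inner_smul_left, real_inner_comm, inv_mul_le_iff₀ hp] at h3
  linarith

/-- first-order optimality -/
lemma aux_opt (W : Set (Vec d)) (hW : Convex ℝ W) (nrm : Vec d → ℝ) (g : Vec d → Vec d)
    (hgrad : ∀ x : Vec d, HasGradientAt (fun v : Vec d => nrm v ^ 2 / 2) (g x) x)
    (c u m : Vec d) (s : ℝ) (hm : m ∈ W)
    (hmin : IsMinOn (fun x => (⟪c, x⟫ : ℝ) + s / 2 * nrm (x - u) ^ 2) W m)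
    (x : Vec d) (hx : x ∈ W) : 0 ≤ (⟪c, x - m⟫ : ℝ) + s * ⟪g (m - u), x - m⟫ := by
  have h1 := (hgrad (m - u)).hasFDerivAt.comp m ((hasFDerivAt_id m).sub_const u)
  have h2 := ((innerSL ℝ c).hasFDerivAt (x := m)).add (h1.const_mul s)
  have he : (fun x => (⟪c, x⟫ : ℝ) + s / 2 * nrm (x - u) ^ 2) =
      (⇑(innerSL ℝ c) + fun y => s * ((fun v : Vec d => nrm v ^ 2 / 2) ∘ fun x => id x - u) y) := by
    funext y
    simp
    ring
  rw [he] at hmin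
  have h3 := h2.hasFDerivWithinAt (s := W)
  have h4 := (IsMinOn.localize hmin).hasFDerivWithinAt_nonneg h3
    (sub_mem_posTangentConeAt_of_segment_subset (hW.segment_subset hm hx))
  simpa using h4

lemma aux_three (W : Set (Vec d)) (hW : Convex ℝ W) (nrm : Vec d → ℝ) (g : Vec d → Vec d)
    (γ : ℝ)
    (hgrad : ∀ x : Vec d, HasGradientAt (fun v : Vec d => nrm v ^ 2 / 2) (g x) x)
    (hstrong : ∀ v x : Vec d,
      nrm v ^ 2 / 2 + ⟪g v, x - v⟫ + γ / 2 * nrm (x - v) ^ 2 ≤ nrm x ^ 2 / 2)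
    (c u m : Vec d) (s : ℝ) (hs : 0 ≤ s) (hm : m ∈ W)
    (hmin : IsMinOn (fun x => (⟪c, x⟫ : ℝ) + s / 2 * nrm (x - u) ^ 2) W m)
    (x : Vec d) (hx : x ∈ W) :
    (⟪c, m⟫ : ℝ) + s / 2 * nrm (m - u) ^ 2 + s * (γ / 2) * nrm (x - m) ^ 2
      ≤ (⟪c, x⟫ : ℝ) + s / 2 * nrm (x - u) ^ 2 := by
  have h1 := aux_opt W hW nrm g hgrad c u m s hm hmin x hx
  have h2 := mul_le_mul_of_nonneg_left (hstrong (m - u) (x - u)) hs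
  rw [sub_sub_sub_cancel_right] at h2
  rw [inner_sub_right] at h1
  linarith

/-- the scalar one-step inequality -/
lemma aux_scalar (α γ p q r : ℝ) (hγ0 : 0 < γ) (h1 : α ^ 2 ≤ 1 / 32)
    (h2 : α ^ 2 * γ ≤ 3 / 16) :
    α * γ * (p + q) * r - p ^ 2 / 2 - γ / 2 * r ^ 2
      ≤ - p ^ 2 / 8 + γ / 16 * q ^ 2 - γ / 4 * r ^ 2 := by
  have a1 : 0 ≤ γ * (α * (p + q) - r / 2) ^ 2 := by positivity
  have a2 : 0 ≤ (α ^ 2 * γ) * (p - q) ^ 2 := by positivity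
  have a3 := mul_le_mul_of_nonneg_right h2 (sq_nonneg p)
  have a4 := mul_le_mul_of_nonneg_right h1 (by positivity : 0 ≤ γ * q ^ 2)
  nlinarith

end aux

set_option maxHeartbeats 4000000

/-- **Theorem 1, case σ > 0, distance bound.**
Under Assumptions 1, 2 and 4 (existence of a σ-weak solution with σ > 0), the best
iterate `w kt` returned by OptDE run with this σ for `K ≥ 1` iterations satisfies
`‖w̃_K − w*‖ ≤ (C₀/σ) ‖w₀ − w*‖ √(L / (A_{K−1} + a₁))` with `C₀ = (1 + δ/(αγ)) √(8α/γ)`. -/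
theorem optde_sigma_pos_distance_bound
    {d : ℕ} (W : Set (Vec d)) (hWne : W.Nonempty) (hWcl : IsClosed W) (hWcv : Convex ℝ W)
    (F : Vec d → Vec d) (nrm : Vec d → ℝ) (g : Vec d → Vec d)
    (L γ δ α σ : ℝ)
    -- `nrm` is a norm on ℝ^d
    (hnrm_pos : ∀ x : Vec d, x ≠ 0 → 0 < nrm x)
    (hnrm_add : ∀ x y : Vec d, nrm (x + y) ≤ nrm x + nrm y)
    (hnrm_smul : ∀ (c : ℝ) (x : Vec d), nrm (c • x) = |c| * nrm x)
    (hL : 0 < L) (hγ0 : 0 < γ) (hγ1 : γ ≤ 1) (hδ : 0 < δ) (hσ : 0 < σ)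
    -- Assumption 1
    (hLip : ∀ v ∈ W, ∀ u ∈ W, dualNorm nrm (F v - F u) ≤ L * nrm (v - u))
    -- Assumption 2
    (hgrad : ∀ x : Vec d, HasGradientAt (fun v : Vec d => nrm v ^ 2 / 2) (g x) x)
    (hstrong : ∀ v x : Vec d,
      nrm v ^ 2 / 2 + ⟪g v, x - v⟫ + γ / 2 * nrm (x - v) ^ 2 ≤ nrm x ^ 2 / 2)
    (hgbound : ∀ x : Vec d, dualNorm nrm (g x) ≤ δ * nrm x)
    -- OptDE algorithm with parameter σ
    (hα0 : 0 < α)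
    (hαle : α ≤ min (1 / (4 * Real.sqrt 2)) (Real.sqrt 3 / (4 * Real.sqrt γ)))
    (a A : ℕ → ℝ) (hA0 : A 0 = 0)
    (ha : ∀ k, 1 ≤ k → a k = α * γ * (1 + σ * A (k - 1)) / L)
    (hArec : ∀ k, 1 ≤ k → A k = A (k - 1) + a k)
    (w z : ℕ → Vec d) (hw0W : w 0 ∈ W) (hz0 : z 0 = w 0)
    -- Assumption 4: existence of a σ-weak solution w* (w.r.t. the center w 0)
    (wstar : Vec d) (hwsW : wstar ∈ W)
    (hsweak : ∀ v ∈ W,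
      σ / γ * (breg nrm g (v - w 0) (wstar - w 0) + breg nrm g (wstar - w 0) (v - w 0)) ≤
        (⟪F v, v - wstar⟫ : ℝ))
    -- extrapolation step
    (hwk : ∀ k, 1 ≤ k → w k ∈ W ∧
      IsMinOn (fun x => (⟪(α / L) • F (w (k - 1)), x⟫ : ℝ) +
        1 / (2 * γ) * nrm (x - z (k - 1)) ^ 2) W (w k))
    -- dual averaging step
    (hzk : ∀ k, 1 ≤ k → z k ∈ W ∧
      IsMinOn (fun x =>
        (⟪∑ i ∈ Finset.Icc 1 k, a i • (F (w i) - (σ / γ) • g (w i - w 0)), x⟫ : ℝ) +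
        (1 + σ * A k) / (2 * γ) * nrm (x - w 0) ^ 2) W (z k))
    (K : ℕ) (hK : 1 ≤ K)
    -- the returned best iterate w̃_K = w kt
    (kt : ℕ) (hktmem : kt ∈ Finset.Icc 1 K)
    (hbest : ∀ k ∈ Finset.Icc 1 K,
      nrm (w kt - z (kt - 1)) + nrm (w (kt - 1) - z (kt - 1)) ≤
        nrm (w k - z (k - 1)) + nrm (w (k - 1) - z (k - 1)))
    :
    nrm (w kt - wstar) ≤
      ((1 + δ / (α * γ)) * Real.sqrt (8 * α / γ) / σ) * nrm (w 0 - wstar) *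
        Real.sqrt (L / (A (K - 1) + a 1)) := by
  have h0 : nrm 0 = 0 := by simpa using hnrm_smul 0 0
  have hnn : ∀ x, 0 ≤ nrm x := by
    intro x
    by_cases hx : x = 0
    · rw [hx, h0]
    · exact (hnrm_pos x hx).le
  have hneg : ∀ x y, nrm (x - y) = nrm (y - x) := by
    intro x y
    have := hnrm_smul (-1) (y - x)
    simpa using this
  have hcont := aux_cont nrm g hnn hgrad
  have hdual := aux_dual nrm hnrm_pos hnrm_smul hcont
  have ha' : ∀ n, a (n + 1) = α * γ * (1 + σ * A n) / L := fun n => by simpa using ha (n + 1) (by omega)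
  have hA' : ∀ n, A (n + 1) = A n + a (n + 1) := fun n => by simpa using hArec (n + 1) (by omega)
  have hAnn : ∀ n, 0 ≤ A n := by
    intro n
    induction n with
    | zero => rw [hA0]
    | succ n ih => rw [hA', ha']; positivity
  have hapos : ∀ n, 0 < a (n + 1) := by
    intro n
    have := hAnn n
    rw [ha']; positivity
  have hwW : ∀ n, w n ∈ W := by
    intro n
    cases n with
    | zero => exact hw0W
    | succ n => exact (hwk (n + 1) (by omega)).1
  have hzW : ∀ n, z n ∈ W := by
    intro n
    cases n with
    | zero => rw [hz0]; exact hw0W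
    | succ n => exact (hzk (n + 1) (by omega)).1
  have hwmin : ∀ n, IsMinOn (fun x => (⟪(α / L) • F (w n), x⟫ : ℝ) +
        (1 / γ) / 2 * nrm (x - z n) ^ 2) W (w (n + 1)) := by
    intro n
    have := (hwk (n + 1) (by omega)).2
    have e : 1 / (2 * γ) = 1 / γ / 2 := by field_simp
    rw [e] at this
    simpa using this
  set S : ℕ → Vec d := fun k =>
    ∑ i ∈ Finset.Icc 1 k, a i • (F (w i) - (σ / γ) • g (w i - w 0)) with hS
  set C : ℕ → ℝ := fun k =>
    ∑ i ∈ Finset.Icc 1 k, a i * (⟪F (w i), w i⟫ - (σ / γ) * ⟪g (w i - w 0), w i⟫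
      + σ / γ * (nrm (w i - w 0) ^ 2 / 2)) with hC
  have hS0 : S 0 = 0 := by simp [hS]
  have hC0 : C 0 = 0 := by simp [hC]
  have hS' : ∀ n x, (⟪S (n + 1), x⟫ : ℝ) = ⟪S n, x⟫ + a (n + 1) * (⟪F (w (n + 1)), x⟫
      - (σ / γ) * ⟪g (w (n + 1) - w 0), x⟫) := by
    intro n x
    have : S (n + 1) = S n + a (n + 1) • (F (w (n + 1)) - (σ / γ) • g (w (n + 1) - w 0)) := by
      simp only [hS]
      rw [Finset.sum_Icc_succ_top (by omega)]
    rw [this, inner_add_left, real_inner_smul_left, inner_sub_left, real_inner_smul_left]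
  have hC' : ∀ n, C (n + 1) = C n + a (n + 1) * (⟪F (w (n + 1)), w (n + 1)⟫
      - (σ / γ) * ⟪g (w (n + 1) - w 0), w (n + 1)⟫
      + σ / γ * (nrm (w (n + 1) - w 0) ^ 2 / 2)) := by
    intro n
    simp only [hC]
    rw [Finset.sum_Icc_succ_top (by omega)]
  have hzthree : ∀ n, ∀ x ∈ W, (⟪S n, z n⟫ : ℝ) + (1 + σ * A n) / γ / 2 * nrm (z n - w 0) ^ 2
      + (1 + σ * A n) / 2 * nrm (x - z n) ^ 2
      ≤ (⟪S n, x⟫ : ℝ) + (1 + σ * A n) / γ / 2 * nrm (x - w 0) ^ 2 := by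
    intro n x hx
    cases n with
    | zero =>
      rw [hS0, hz0, hA0]
      simp only [inner_zero_left, sub_self, h0]
      have : (1:ℝ) ≤ 1 / γ := by rw [le_div_iff₀ hγ0]; linarith
      have := mul_le_mul_of_nonneg_right this (sq_nonneg (nrm (x - w 0)))
      simp only [mul_zero, add_zero]
      nlinarith
    | succ n =>
      have hB := hAnn (n + 1)
      have hm := (hzk (n + 1) (by omega)).2
      have e : (1 + σ * A (n + 1)) / (2 * γ) = (1 + σ * A (n + 1)) / γ / 2 := by field_simp
      rw [e] at hm
      have := aux_three W hWcv nrm g γ hgrad hstrong _ _ _ _ (by positivity) (hzW (n + 1)) hm x hx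
      have e2 : (1 + σ * A (n + 1)) / γ * (γ / 2) = (1 + σ * A (n + 1)) / 2 := by field_simp
      rw [e2] at this
      exact this
  -- weak solution lower bound
  have hlow : ∀ n, 0 ≤ C n - ⟪S n, wstar⟫ - σ / γ * A n * (nrm (wstar - w 0) ^ 2 / 2) := by
    intro n
    induction n with
    | zero => rw [hC0, hS0, hA0]; simp
    | succ n ih =>
      rw [hC', hS', hA']
      have h1 := hsweak _ (hwW (n + 1))
      have h2 : 0 ≤ breg nrm g (wstar - w 0) (w (n + 1) - w 0) := by
        have := hstrong (wstar - w 0) (w (n + 1) - w 0)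
        have h3 : 0 ≤ γ / 2 * nrm (w (n + 1) - w 0 - (wstar - w 0)) ^ 2 := by positivity
        unfold breg
        linarith
      have h4 : σ / γ * breg nrm g (w (n + 1) - w 0) (wstar - w 0) ≤
          ⟪F (w (n + 1)), w (n + 1) - wstar⟫ := by
        have : 0 ≤ σ / γ * breg nrm g (wstar - w 0) (w (n + 1) - w 0) := by positivity
        linarith
      unfold breg at h4
      rw [sub_sub_sub_cancel_right, inner_sub_right, inner_sub_right] at h4
      have h5 := mul_le_mul_of_nonneg_left h4 (hapos n).le
      linarith
  -- parameters
  have hα1 : α ^ 2 ≤ 1 / 32 := by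
    have h1 := hαle.trans (min_le_left _ _)
    have h2 : α ^ 2 ≤ (1 / (4 * Real.sqrt 2)) ^ 2 := by gcongr
    rw [div_pow, mul_pow, Real.sq_sqrt (by norm_num)] at h2
    norm_num at h2
    linarith
  have hα2 : α ^ 2 * γ ≤ 3 / 16 := by
    have h1 := hαle.trans (min_le_right _ _)
    have h2 : α ^ 2 ≤ (Real.sqrt 3 / (4 * Real.sqrt γ)) ^ 2 := by gcongr
    rw [div_pow, mul_pow, Real.sq_sqrt (by norm_num), Real.sq_sqrt hγ0.le,
      le_div_iff₀ (by positivity)] at h2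
    linarith
  have hlipin : ∀ n x, (⟪F (w (n + 1)) - F (w n), x⟫ : ℝ) ≤
      L * (nrm (w (n + 1) - z n) + nrm (w n - z n)) * nrm x := by
    intro n x
    have h1 := hdual x (F (w (n + 1)) - F (w n))
    have h2 := hLip _ (hwW (n + 1)) _ (hwW n)
    have h3 : nrm (w (n + 1) - w n) ≤ nrm (w (n + 1) - z n) + nrm (w n - z n) := by
      have := hnrm_add (w (n + 1) - z n) (z n - w n)
      rw [sub_add_sub_cancel, hneg (z n) (w n)] at this
      exact this
    have h4 := hnn x
    calc _ ≤ _ := h1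
      _ ≤ (L * nrm (w (n + 1) - w n)) * nrm x := by gcongr
      _ ≤ _ := by gcongr
  -- one step
  have hstep : ∀ n, C (n + 1) - ⟪S (n + 1), z (n + 1)⟫
        - (1 + σ * A (n + 1)) / γ / 2 * nrm (z (n + 1) - w 0) ^ 2
      ≤ C n - ⟪S n, z n⟫ - (1 + σ * A n) / γ / 2 * nrm (z n - w 0) ^ 2
        + (1 + σ * A n) * (- nrm (w (n + 1) - z n) ^ 2 / 8 + γ / 16 * nrm (w n - z n) ^ 2)
        - γ / 4 * (1 + σ * A (n + 1)) * nrm (w (n + 1) - z (n + 1)) ^ 2 := by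
    intro n
    have hB : 0 < 1 + σ * A n := by have := hAnn n; positivity
    have hap := hapos n
    have I1 := hzthree n _ (hzW (n + 1))
    have I2 := mul_le_mul_of_nonneg_left (hstrong (w (n + 1) - w 0) (z (n + 1) - w 0))
      (by positivity : 0 ≤ a (n + 1) * (σ / γ))
    rw [sub_sub_sub_cancel_right, inner_sub_right, hneg (z (n + 1)) (w (n + 1))] at I2
    have I3 := mul_le_mul_of_nonneg_left
      (aux_three W hWcv nrm g γ hgrad hstrong _ _ _ _ (by positivity) (hwW (n + 1)) (hwmin n)
        _ (hzW (n + 1))) (by positivity : 0 ≤ γ * (1 + σ * A n))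
    rw [real_inner_smul_left, real_inner_smul_left, hneg (z (n + 1)) (w (n + 1))] at I3
    have I4 := mul_le_mul_of_nonneg_left (hlipin n (w (n + 1) - z (n + 1))) hap.le
    rw [inner_sub_left, inner_sub_right, inner_sub_right] at I4
    have I5 := mul_le_mul_of_nonneg_left (aux_scalar α γ (nrm (w (n + 1) - z n))
      (nrm (w n - z n)) (nrm (w (n + 1) - z (n + 1))) hγ0 hα1 hα2) hB.le
    rw [hC', hS', hA']
    have hq : a (n + 1) * L = α * γ * (1 + σ * A n) := by rw [ha']; field_simp
    generalize (⟪F (w n), w (n + 1)⟫ : ℝ) = f1 at *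
    generalize (⟪F (w n), z (n + 1)⟫ : ℝ) = f2 at *
    generalize (⟪F (w (n + 1)), w (n + 1)⟫ : ℝ) = f3 at *
    generalize (⟪F (w (n + 1)), z (n + 1)⟫ : ℝ) = f4 at *
    generalize nrm (w (n + 1) - z n) = p at *
    generalize nrm (w n - z n) = q at *
    generalize nrm (w (n + 1) - z (n + 1)) = r at *
    generalize nrm (z (n + 1) - z n) = y at *
    have I3' : a (n + 1) * f1 + (1 + σ * A n) / 2 * p ^ 2 + γ * (1 + σ * A n) / 2 * r ^ 2 ≤
        a (n + 1) * f2 + (1 + σ * A n) / 2 * y ^ 2 := by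
      have e1 : γ * (1 + σ * A n) * (α / L * f1 + 1 / γ / 2 * p ^ 2 + 1 / γ * (γ / 2) * r ^ 2)
        = a (n + 1) * f1 + (1 + σ * A n) / 2 * p ^ 2 + γ * (1 + σ * A n) / 2 * r ^ 2 := by
        rw [ha']; field_simp
      have e2 : γ * (1 + σ * A n) * (α / L * f2 + 1 / γ / 2 * y ^ 2)
        = a (n + 1) * f2 + (1 + σ * A n) / 2 * y ^ 2 := by
        rw [ha']; field_simp
      rw [e1, e2] at I3
      exact I3
    have I4' : a (n + 1) * (f3 - f4 - (f1 - f2)) ≤ (1 + σ * A n) * (α * γ * (p + q) * r) := by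
      refine I4.trans (le_of_eq ?_)
      linear_combination (p + q) * r * hq
    have e3 : (1 + σ * (A n + a (n + 1))) / γ = (1 + σ * A n) / γ + a (n + 1) * (σ / γ) := by
      field_simp
      ring
    rw [e3]
    have e4 : a (n + 1) * (σ / γ) * (γ / 2 * r ^ 2) = a (n + 1) * σ / 2 * r ^ 2 := by
      field_simp
    rw [mul_add, e4] at I2
    have I6 : γ / 4 * (σ * a (n + 1)) * r ^ 2 ≤ a (n + 1) * σ / 2 * r ^ 2 := by
      have : 0 ≤ (σ * a (n + 1)) * r ^ 2 := by positivity
      nlinarith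
    linarith
  set ρ := nrm (w kt - z (kt - 1)) + nrm (w (kt - 1) - z (kt - 1)) with hρ
  have hρ0 : 0 ≤ ρ := add_nonneg (hnn _) (hnn _)
  have hind : ∀ n ≤ K, C n - ⟪S n, z n⟫ - (1 + σ * A n) / γ / 2 * nrm (z n - w 0) ^ 2
      ≤ - (γ / 16 * ρ ^ 2 * (L / (α * γ) * A n))
        - γ / 4 * (1 + σ * A n) * nrm (w n - z n) ^ 2 := by
    intro n
    induction n with
    | zero => intro _; rw [hC0, hS0, hA0, hz0]; simp [h0]
    | succ n ih =>
      intro hn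
      have ih := ih (by omega)
      have hB : 0 < 1 + σ * A n := by have := hAnn n; positivity
      have h1 := hstep n
      have h2 := hbest (n + 1) (Finset.mem_Icc.2 ⟨by omega, hn⟩)
      simp only [Nat.add_sub_cancel] at h2
      have e : L / (α * γ) * A (n + 1) = L / (α * γ) * A n + (1 + σ * A n) := by
        rw [hA', ha']; field_simp
      rw [e]
      have hp := hnn (w (n + 1) - z n)
      generalize nrm (w (n + 1) - z n) = p at *
      generalize nrm (w n - z n) = q at *
      have h3 : ρ ^ 2 ≤ (p + q) ^ 2 := by gcongr
      have h4 : γ / 16 * ρ ^ 2 ≤ p ^ 2 / 8 + 3 * γ / 16 * q ^ 2 := by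
        have b1 : γ * ρ ^ 2 ≤ γ * (p + q) ^ 2 := by gcongr
        have b2 : 0 ≤ γ * (p - q) ^ 2 := by positivity
        have b3 : γ * p ^ 2 ≤ 1 * p ^ 2 := by gcongr
        have b4 : 0 ≤ γ * q ^ 2 := by positivity
        nlinarith
      have h5 := mul_le_mul_of_nonneg_left h4 hB.le
      linarith
  -- bound on ρ
  have hρb : γ / 16 * ρ ^ 2 * (L / (α * γ) * A K) ≤ 1 / γ * (nrm (w 0 - wstar) ^ 2 / 2) := by
    have h1 := hind K le_rfl
    have h2 := hzthree K _ hwsW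
    have h3 := hlow K
    have hB : 0 < 1 + σ * A K := by have := hAnn K; positivity
    have h4 : 0 ≤ (1 + σ * A K) / 2 * nrm (wstar - z K) ^ 2 := by positivity
    have h5 : 0 ≤ γ / 4 * (1 + σ * A K) * nrm (w K - z K) ^ 2 := by positivity
    rw [hneg (w 0) wstar]
    have e : (1 + σ * A K) / γ / 2 * nrm (wstar - w 0) ^ 2 =
      1 / γ * (nrm (wstar - w 0) ^ 2 / 2) + σ / γ * A K * (nrm (wstar - w 0) ^ 2 / 2) := by
      field_simp
    rw [e] at h2
    linarith
  have hAK : A (K - 1) + a 1 ≤ A K := by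
    rw [hArec K hK, ha K hK, ha 1 le_rfl]
    have := hAnn (K - 1)
    simp only [Nat.sub_self, hA0]
    gcongr
  have hQ : 0 < A (K - 1) + a 1 := add_pos_of_nonneg_of_pos (hAnn _) (hapos 0)
  have hρsq : ρ * L ≤ Real.sqrt (8 * α / γ) * nrm (w 0 - wstar) *
      Real.sqrt (L / (A (K - 1) + a 1)) := by
    refine abs_le_of_sq_le_sq' ?_ (by have := hnn (w 0 - wstar); positivity) |>.2
    rw [mul_pow, mul_pow, mul_pow, Real.sq_sqrt (by positivity), Real.sq_sqrt (by positivity)]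
    have h1 : γ / 16 * ρ ^ 2 * (L / (α * γ) * (A (K - 1) + a 1)) ≤
        1 / γ * (nrm (w 0 - wstar) ^ 2 / 2) := by
      refine le_trans ?_ hρb
      gcongr
    have h2 := mul_le_mul_of_nonneg_left h1
      (by positivity : 0 ≤ 16 * α * L / (A (K - 1) + a 1))
    have e1 : 16 * α * L / (A (K - 1) + a 1) *
      (γ / 16 * ρ ^ 2 * (L / (α * γ) * (A (K - 1) + a 1))) = ρ ^ 2 * L ^ 2 := by
      field_simp
    have e2 : 16 * α * L / (A (K - 1) + a 1) * (1 / γ * (nrm (w 0 - wstar) ^ 2 / 2))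
      = 8 * α / γ * nrm (w 0 - wstar) ^ 2 * (L / (A (K - 1) + a 1)) := by
      field_simp
      ring
    rw [e1, e2] at h2
    exact h2
  -- distance
  have hdist : σ * nrm (w kt - wstar) ≤ (1 + δ / (α * γ)) * (ρ * L) := by
    obtain ⟨n, rfl⟩ : ∃ n, kt = n + 1 := ⟨kt - 1, by have := (Finset.mem_Icc.1 hktmem).1; omega⟩
    simp only [Nat.add_sub_cancel] at hρ
    have h1 := hsweak _ (hwW (n + 1))
    have h2 := hstrong (wstar - w 0) (w (n + 1) - w 0)
    have h3 := hstrong (w (n + 1) - w 0) (wstar - w 0)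
    have h4 := aux_opt W hWcv nrm g hgrad _ _ _ _ (hwW (n + 1)) (hwmin n) _ hwsW
    have h5 := hlipin n (w (n + 1) - wstar)
    have h6 := hdual (wstar - w (n + 1)) (g (w (n + 1) - z n))
    have h7 := hgbound (w (n + 1) - z n)
    rw [← hρ] at h5
    rw [sub_sub_sub_cancel_right] at h2 h3
    unfold breg at h1
    rw [sub_sub_sub_cancel_right, sub_sub_sub_cancel_right] at h1
    rw [hneg wstar (w (n + 1))] at h3 h6
    rw [real_inner_smul_left] at h4
    set N := nrm (w (n + 1) - wstar) with hN
    have hN0 : 0 ≤ N := hnn _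
    have k1 : σ * N ^ 2 ≤ ⟪F (w (n + 1)), w (n + 1) - wstar⟫ := by
      refine le_trans ?_ h1
      calc σ * N ^ 2 = σ / γ * (γ * N ^ 2) := by field_simp
        _ ≤ _ := by
          gcongr
          linarith
    have k2 : ⟪g (w (n + 1) - z n), wstar - w (n + 1)⟫ ≤ δ * ρ * N := by
      have : nrm (w (n + 1) - z n) ≤ ρ := by rw [hρ]; linarith [hnn (w n - z n)]
      calc _ ≤ _ := h6
        _ ≤ (δ * nrm (w (n + 1) - z n)) * N := by gcongr
        _ ≤ _ := by gcongr
    have k3 : (⟪F (w n), wstar - w (n + 1)⟫ : ℝ) = - ⟪F (w n), w (n + 1) - wstar⟫ := by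
      rw [← inner_neg_right, neg_sub]
    rw [k3] at h4
    rw [inner_sub_left] at h5
    have k4 : ⟪F (w n), w (n + 1) - wstar⟫ ≤ δ / (α * γ) * (ρ * L) * N := by
      have h8 : α / L * ⟪F (w n), w (n + 1) - wstar⟫ ≤ 1 / γ * (δ * ρ * N) := by
        have := mul_le_mul_of_nonneg_left k2 (by positivity : 0 ≤ 1 / γ)
        linarith
      have h9 := mul_le_mul_of_nonneg_left h8 (by positivity : 0 ≤ L / α)
      calc _ = L / α * (α / L * ⟪F (w n), w (n + 1) - wstar⟫) := by field_simp
        _ ≤ _ := h9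
        _ = _ := by field_simp
    rcases hN0.eq_or_lt with hz | hp
    · rw [← hz]
      simp only [mul_zero]
      positivity
    · refine le_of_mul_le_mul_right ?_ hp
      nlinarith
  have hfin : σ * nrm (w kt - wstar) ≤ (1 + δ / (α * γ)) * (Real.sqrt (8 * α / γ) *
      nrm (w 0 - wstar) * Real.sqrt (L / (A (K - 1) + a 1))) := by
    refine hdist.trans ?_
    gcongr
  calc nrm (w kt - wstar) = (σ * nrm (w kt - wstar)) / σ := by field_simp
    _ ≤ _ := div_le_div_of_nonneg_right hfin hσ.le
    _ = _ := by ring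
end

section
/- Proposition 1, last-iterate merit bound: Suppose Assumptions 1, 2 and 4 hold with parameter σ > 0, and run the OptDE algorithm with this σ. Then for every K ≥ 1 and every D > 0 the last iterate w_K satisfies sup{ ⟨F(w_K), w_K − w⟩ : w ∈ 𝒲, ‖w_K − w‖ ≤ D } ≤ C_0 D ‖w_0 − w*‖ √(L / a_{K−1}), where C_0 = (1 + δ/(αγ)) √(8α/γ), a_k = (αγ/L)(1 + αγσ/L)^{k−1} for k ≥ 1, a_0 := a_1, and w* is the σ-weak solution from Assumption 4. -/
open scoped RealInnerProductSpace
open Finset MeasureTheory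

lemma optde_dual_bound {d : ℕ} (nrm : Vec d → ℝ) (g : Vec d → Vec d)
    (hnrm_pos : ∀ x : Vec d, x ≠ 0 → 0 < nrm x)
    (hnrm_smul : ∀ (c : ℝ) (x : Vec d), nrm (c • x) = |c| * nrm x)
    (hgrad : ∀ x : Vec d, HasGradientAt (fun v : Vec d => nrm v ^ 2 / 2) (g x) x)
    (x y : Vec d) : (⟪y, x⟫ : ℝ) ≤ dualNorm nrm y * nrm x := by
  have h0 : nrm 0 = 0 := by simpa using hnrm_smul 0 0
  by_cases hx : x = 0
  · subst hx; simp [h0]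
  have hnn : ∀ x, 0 ≤ nrm x := fun x => by
    by_cases h : x = 0
    · rw [h, h0]
    · exact (hnrm_pos x h).le
  have hcont : Continuous nrm := by
    have h1 : Continuous (fun v : Vec d => nrm v ^ 2 / 2) :=
      continuous_iff_continuousAt.2 fun v => (hgrad v).continuousAt
    have h2 : nrm = fun v => Real.sqrt (2 * (nrm v ^ 2 / 2)) := by
      funext v
      rw [show 2 * (nrm v ^ 2 / 2) = nrm v ^ 2 by ring, Real.sqrt_sq (hnn v)]
    rw [h2]
    exact (continuous_const.mul h1).sqrt
  have hbdd : BddAbove ((fun x => (⟪x, y⟫ : ℝ)) '' {x | nrm x ≤ 1}) := by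
    have hne : (Metric.sphere (0 : Vec d) 1).Nonempty := by
      refine ⟨(‖x‖⁻¹ : ℝ) • x, ?_⟩
      have : ‖x‖ ≠ 0 := norm_ne_zero_iff.2 hx
      simp [norm_smul, this]
    obtain ⟨m, hm, hmin⟩ := (isCompact_sphere (0 : Vec d) 1).exists_isMinOn hne hcont.continuousOn
    have hm0 : m ≠ 0 := by
      rintro rfl
      simp at hm
    have hmp := hnrm_pos m hm0
    refine ⟨(nrm m)⁻¹ * ‖y‖, ?_⟩
    rintro _ ⟨u, hu, rfl⟩
    have hu' : nrm u ≤ 1 := hu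
    have hub : ‖u‖ ≤ (nrm m)⁻¹ := by
      by_cases hu0 : u = 0
      · subst hu0; simp [hmp.le]
      have hn : 0 < ‖u‖ := norm_pos_iff.2 hu0
      have hs : (‖u‖⁻¹ : ℝ) • u ∈ Metric.sphere (0 : Vec d) 1 := by
        simp [norm_smul, hn.ne']
      have h3 : nrm m ≤ nrm ((‖u‖⁻¹ : ℝ) • u) := hmin hs
      rw [hnrm_smul, abs_of_pos (inv_pos.2 hn)] at h3
      rw [le_inv_comm₀ hn hmp]
      calc nrm m ≤ ‖u‖⁻¹ * nrm u := h3
        _ ≤ ‖u‖⁻¹ * 1 := by gcongr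
        _ = _ := mul_one _
    calc (⟪u, y⟫ : ℝ) ≤ ‖u‖ * ‖y‖ := real_inner_le_norm _ _
      _ ≤ _ := by gcongr
  have hxp := hnrm_pos x hx
  have key : (⟪(nrm x)⁻¹ • x, y⟫ : ℝ) ≤ dualNorm nrm y := by
    apply le_csSup hbdd
    refine ⟨(nrm x)⁻¹ • x, ?_, rfl⟩
    show nrm _ ≤ 1
    rw [hnrm_smul, abs_of_pos (inv_pos.2 hxp), inv_mul_cancel₀ hxp.ne']
  rw [real_inner_smul_left, inv_mul_le_iff₀ hxp] at key
  rw [real_inner_comm]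
  linarith

lemma optde_first_order {d : ℕ} (W : Set (Vec d)) (hWcv : Convex ℝ W)
    (nrm : Vec d → ℝ) (g : Vec d → Vec d)
    (hgrad : ∀ x : Vec d, HasGradientAt (fun v : Vec d => nrm v ^ 2 / 2) (g x) x)
    (s u p : Vec d) (c : ℝ) (hp : p ∈ W)
    (hmin : IsMinOn (fun x => (⟪s, x⟫ : ℝ) + c / 2 * nrm (x - u) ^ 2) W p)
    (v : Vec d) (hv : v ∈ W) :
    0 ≤ (⟪s, v - p⟫ : ℝ) + c * ⟪g (p - u), v - p⟫ := by
  have h1 : HasFDerivAt (fun x => (⟪s, x⟫ : ℝ)) (innerSL ℝ s) p := (innerSL ℝ s).hasFDerivAt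
  have h2 := (hgrad (p - u)).hasFDerivAt
  have h3 := h2.comp p ((hasFDerivAt_id p).sub_const u)
  have h4 := h1.add (h3.const_mul c)
  have h5 : (fun x => (⟪s, x⟫ : ℝ) + c / 2 * nrm (x - u) ^ 2) =
      (fun x => (⟪s, x⟫ : ℝ)) + fun x => c * ((fun v : Vec d => nrm v ^ 2 / 2) ∘ fun x => id x - u) x := by
    funext x
    simp
    ring
  rw [h5] at hmin
  have h6 := hmin.localize.hasFDerivWithinAt_nonneg h4.hasFDerivWithinAt
    (sub_mem_posTangentConeAt_of_segment_subset (hWcv.segment_subset hp hv))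
  simpa using h6

lemma optde_growth {d : ℕ} (W : Set (Vec d)) (hWcv : Convex ℝ W)
    (nrm : Vec d → ℝ) (g : Vec d → Vec d) (γ : ℝ)
    (hgrad : ∀ x : Vec d, HasGradientAt (fun v : Vec d => nrm v ^ 2 / 2) (g x) x)
    (hstrong : ∀ v x : Vec d,
      nrm v ^ 2 / 2 + ⟪g v, x - v⟫ + γ / 2 * nrm (x - v) ^ 2 ≤ nrm x ^ 2 / 2)
    (s u p : Vec d) (c : ℝ) (hc : 0 ≤ c) (hp : p ∈ W)
    (hmin : IsMinOn (fun x => (⟪s, x⟫ : ℝ) + c / 2 * nrm (x - u) ^ 2) W p)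
    (v : Vec d) (hv : v ∈ W) :
    c * γ / 2 * nrm (v - p) ^ 2 ≤
      (⟪s, v - p⟫ : ℝ) + c / 2 * nrm (v - u) ^ 2 - c / 2 * nrm (p - u) ^ 2 := by
  have h1 := optde_first_order W hWcv nrm g hgrad s u p c hp hmin v hv
  have h2 := mul_le_mul_of_nonneg_left (hstrong (p - u) (v - u)) hc
  rw [show v - u - (p - u) = v - p by abel] at h2
  linarith

/-- Scalar part of the one-step estimate. -/
lemma optde_scalar (α γ B p q r q' e : ℝ) (hα : 0 < α) (hα2 : α ^ 2 ≤ 1 / 32)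
    (hγ0 : 0 < γ) (hγ1 : γ ≤ 1) (hB : 0 < B) (hr0 : 0 ≤ r) (hr : r ≤ p + q) (he : 0 ≤ e) :
    (B + e) * γ / 4 * q' ^ 2 - B * γ / 16 * q ^ 2 + 7 / 16 * B * p ^ 2 ≤
      B / 2 * (γ * q' ^ 2 + p ^ 2) - α * γ * B * (r * q') + e / 2 * q' ^ 2 := by
  have h1 : r ^ 2 ≤ 2 * p ^ 2 + 2 * q ^ 2 := by nlinarith [sq_nonneg (p - q)]
  have h2 : α * (r * q') ≤ q' ^ 2 / 4 + (p ^ 2 + q ^ 2) / 16 := by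
    nlinarith [sq_nonneg (q' / 2 - α * r), sq_nonneg r, mul_le_mul_of_nonneg_right hα2 (sq_nonneg r)]
  have h3 := mul_le_mul_of_nonneg_left h2 (mul_pos hγ0 hB).le
  have h4 : e * γ * q' ^ 2 ≤ e * 1 * q' ^ 2 := by gcongr
  have h5 : γ * B * p ^ 2 ≤ 1 * B * p ^ 2 := by gcongr
  nlinarith [mul_nonneg he (sq_nonneg q')]

set_option maxHeartbeats 2000000 in
/-- **Proposition 1, last-iterate merit bound.**
Under Assumptions 1, 2 and 4 (σ > 0), for every `K ≥ 1` the last iterate `w K` of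
OptDE satisfies
`sup{⟪F(w_K), w_K − v⟫ : v ∈ W, ‖w_K − v‖ ≤ D} ≤ C₀ D ‖w₀ − w*‖ √(L / a_{K−1})`
with `C₀ = (1 + δ/(αγ)) √(8α/γ)` and the convention `a 0 = a 1`. -/
theorem optde_last_iterate_merit_bound
    {d : ℕ} (W : Set (Vec d)) (hWne : W.Nonempty) (hWcl : IsClosed W) (hWcv : Convex ℝ W)
    (F : Vec d → Vec d) (nrm : Vec d → ℝ) (g : Vec d → Vec d)
    (L γ δ α σ : ℝ)
    -- `nrm` is a norm on ℝ^d
    (hnrm_pos : ∀ x : Vec d, x ≠ 0 → 0 < nrm x)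
    (hnrm_add : ∀ x y : Vec d, nrm (x + y) ≤ nrm x + nrm y)
    (hnrm_smul : ∀ (c : ℝ) (x : Vec d), nrm (c • x) = |c| * nrm x)
    (hL : 0 < L) (hγ0 : 0 < γ) (hγ1 : γ ≤ 1) (hδ : 0 < δ) (hσ : 0 < σ)
    -- Assumption 1
    (hLip : ∀ v ∈ W, ∀ u ∈ W, dualNorm nrm (F v - F u) ≤ L * nrm (v - u))
    -- Assumption 2
    (hgrad : ∀ x : Vec d, HasGradientAt (fun v : Vec d => nrm v ^ 2 / 2) (g x) x)
    (hstrong : ∀ v x : Vec d,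
      nrm v ^ 2 / 2 + ⟪g v, x - v⟫ + γ / 2 * nrm (x - v) ^ 2 ≤ nrm x ^ 2 / 2)
    (hgbound : ∀ x : Vec d, dualNorm nrm (g x) ≤ δ * nrm x)
    -- OptDE algorithm with parameter σ
    (hα0 : 0 < α)
    (hαle : α ≤ min (1 / (4 * Real.sqrt 2)) (Real.sqrt 3 / (4 * Real.sqrt γ)))
    (a A : ℕ → ℝ) (hA0 : A 0 = 0)
    (ha : ∀ k, 1 ≤ k → a k = α * γ * (1 + σ * A (k - 1)) / L)
    (ha0 : a 0 = a 1)
    (hArec : ∀ k, 1 ≤ k → A k = A (k - 1) + a k)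
    (w z : ℕ → Vec d) (hw0W : w 0 ∈ W) (hz0 : z 0 = w 0)
    -- Assumption 4: existence of a σ-weak solution w* (w.r.t. the center w 0)
    (wstar : Vec d) (hwsW : wstar ∈ W)
    (hsweak : ∀ v ∈ W,
      σ / γ * (breg nrm g (v - w 0) (wstar - w 0) + breg nrm g (wstar - w 0) (v - w 0)) ≤
        (⟪F v, v - wstar⟫ : ℝ))
    -- extrapolation step
    (hwk : ∀ k, 1 ≤ k → w k ∈ W ∧
      IsMinOn (fun x => (⟪(α / L) • F (w (k - 1)), x⟫ : ℝ) +
        1 / (2 * γ) * nrm (x - z (k - 1)) ^ 2) W (w k))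
    -- dual averaging step
    (hzk : ∀ k, 1 ≤ k → z k ∈ W ∧
      IsMinOn (fun x =>
        (⟪∑ i ∈ Finset.Icc 1 k, a i • (F (w i) - (σ / γ) • g (w i - w 0)), x⟫ : ℝ) +
        (1 + σ * A k) / (2 * γ) * nrm (x - w 0) ^ 2) W (z k))
    (K : ℕ) (hK : 1 ≤ K)
    (D : ℝ) (hD : 0 < D) :
    ∀ v ∈ W, nrm (w K - v) ≤ D →
      (⟪F (w K), w K - v⟫ : ℝ) ≤
        ((1 + δ / (α * γ)) * Real.sqrt (8 * α / γ)) * D * nrm (w 0 - wstar) *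
          Real.sqrt (L / a (K - 1)) := by
  have hN0 : nrm 0 = 0 := by simpa using hnrm_smul 0 0
  have hnn : ∀ x, 0 ≤ nrm x := fun x => by
    by_cases h : x = 0
    · rw [h, hN0]
    · exact (hnrm_pos x h).le
  have hneg : ∀ x y, nrm (x - y) = nrm (y - x) := fun x y => by
    have := hnrm_smul (-1) (y - x)
    simpa using this
  have hdual := fun x y => optde_dual_bound nrm g hnrm_pos hnrm_smul hgrad x y
  have hα2 : α ^ 2 ≤ 1 / 32 := by
    have h1 := hαle.trans (min_le_left _ _)
    have h2 : (1 / (4 * Real.sqrt 2)) ^ 2 = 1 / 32 := by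
      rw [div_pow, mul_pow, Real.sq_sqrt (by norm_num)]; norm_num
    rw [← h2]
    exact pow_le_pow_left₀ hα0.le h1 2
  have hA : ∀ n, 0 ≤ A n := by
    intro n
    induction n with
    | zero => rw [hA0]
    | succ n ih =>
      rw [hArec (n + 1) (by omega), ha (n + 1) (by omega)]
      simp only [Nat.add_sub_cancel]
      positivity
  have haS : ∀ n, a (n + 1) = α * γ * (1 + σ * A n) / L := fun n => ha (n + 1) (by omega)
  have hAS : ∀ n, A (n + 1) = A n + a (n + 1) := fun n => hArec (n + 1) (by omega)
  have hwW : ∀ n, w n ∈ W := by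
    intro n
    rcases n with _ | n
    · exact hw0W
    · exact (hwk (n + 1) (by omega)).1
  have hzW : ∀ n, z n ∈ W := by
    intro n
    rcases n with _ | n
    · rw [hz0]; exact hw0W
    · exact (hzk (n + 1) (by omega)).1
  obtain ⟨S, hS⟩ : ∃ S : ℕ → Vec d, S = fun k =>
    ∑ i ∈ Finset.Icc 1 k, a i • (F (w i) - (σ / γ) • g (w i - w 0)) := ⟨_, rfl⟩
  have hS0 : S 0 = 0 := by rw [hS]; simp
  have hSS : ∀ n, S (n + 1) =
      S n + a (n + 1) • (F (w (n + 1)) - (σ / γ) • g (w (n + 1) - w 0)) := by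
    intro n
    rw [hS]
    exact Finset.sum_Icc_succ_top (by omega) _
  have hzmin : ∀ n, IsMinOn (fun x => (⟪S n, x⟫ : ℝ) +
      ((1 + σ * A n) / γ) / 2 * nrm (x - w 0) ^ 2) W (z n) := by
    intro n
    rcases n with _ | n
    · intro x _
      simp only [hS0, hz0, hA0, sub_self, hN0, Set.mem_ofPred_eq]
      simp
      positivity
    · have := (hzk (n + 1) (by omega)).2
      rw [hS, div_div, mul_comm γ 2]
      exact this
  have hwmin : ∀ n, IsMinOn (fun x => (⟪(α / L) • F (w n), x⟫ : ℝ) +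
      (1 / γ) / 2 * nrm (x - z n) ^ 2) W (w (n + 1)) := by
    intro n
    have := (hwk (n + 1) (by omega)).2
    rw [div_div, mul_comm γ 2]
    exact this
  have hBpos : ∀ n, 0 < 1 + σ * A n := fun n => by
    have := hA n
    positivity
  -- energy
  obtain ⟨E, hE⟩ : ∃ E : ℕ → ℝ, ∀ n, E n = ⟪S n, z n - wstar⟫ +
      (1 + σ * A n) / γ / 2 * nrm (z n - w 0) ^ 2 - σ * A n / γ / 2 * nrm (wstar - w 0) ^ 2 :=
    ⟨_, fun _ => rfl⟩
  have hr : ∀ n, nrm (w (n + 1) - w n) ≤ nrm (w (n + 1) - z n) + nrm (z n - w n) := by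
    intro n
    have := hnrm_add (w (n + 1) - z n) (z n - w n)
    simpa using this
  have hstep : ∀ n, E n + (1 + σ * A (n + 1)) * γ / 4 * nrm (z (n + 1) - w (n + 1)) ^ 2
      - (1 + σ * A n) * γ / 16 * nrm (z n - w n) ^ 2
      + 7 / 16 * (1 + σ * A n) * nrm (w (n + 1) - z n) ^ 2 ≤ E (n + 1) := by
    intro n
    have hB := hBpos n
    have hapos : 0 < a (n + 1) := by rw [haS]; positivity
    have e1 := optde_growth W hWcv nrm g γ hgrad hstrong _ _ _ _ (by positivity) (hzW n) (hzmin n)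
      (z (n + 1)) (hzW (n + 1))
    have e2 := hsweak (w (n + 1)) (hwW (n + 1))
    have e2' : 0 ≤ breg nrm g (wstar - w 0) (w (n + 1) - w 0) := by
      have := hstrong (wstar - w 0) (w (n + 1) - w 0)
      unfold breg
      nlinarith [sq_nonneg (nrm (w (n + 1) - w 0 - (wstar - w 0)))]
    have e2a : σ / γ * breg nrm g (w (n + 1) - w 0) (wstar - w 0) ≤
        (⟪F (w (n + 1)), w (n + 1) - wstar⟫ : ℝ) := by
      have : 0 ≤ σ / γ * breg nrm g (wstar - w 0) (w (n + 1) - w 0) := by positivity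
      linarith
    unfold breg at e2a
    rw [show wstar - w 0 - (w (n + 1) - w 0) = wstar - w (n + 1) by abel] at e2a
    have e3 := hstrong (w (n + 1) - w 0) (z (n + 1) - w 0)
    rw [show z (n + 1) - w 0 - (w (n + 1) - w 0) = z (n + 1) - w (n + 1) by abel] at e3
    have e4 := optde_growth W hWcv nrm g γ hgrad hstrong _ _ _ _ (by positivity) (hwW (n + 1))
      (hwmin n) (z (n + 1)) (hzW (n + 1))
    rw [real_inner_smul_left] at e4
    have e5 : -(L * nrm (w (n + 1) - w n) * nrm (z (n + 1) - w (n + 1))) ≤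
        (⟪F (w (n + 1)), z (n + 1) - w (n + 1)⟫ : ℝ) - ⟪F (w n), z (n + 1) - w (n + 1)⟫ := by
      have h1 := hdual (w (n + 1) - z (n + 1)) (F (w (n + 1)) - F (w n))
      have h2 := mul_le_mul_of_nonneg_right (hLip _ (hwW (n + 1)) _ (hwW n))
        (hnn (w (n + 1) - z (n + 1)))
      rw [hneg (z (n + 1))]
      have h3 : (⟪F (w (n + 1)) - F (w n), w (n + 1) - z (n + 1)⟫ : ℝ) =
        -(⟪F (w (n + 1)), z (n + 1) - w (n + 1)⟫ - ⟪F (w n), z (n + 1) - w (n + 1)⟫) := by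
        simp only [inner_sub_left, inner_sub_right]; ring
      linarith
    have e6 := optde_scalar α γ (1 + σ * A n) (nrm (w (n + 1) - z n)) (nrm (z n - w n))
      (nrm (w (n + 1) - w n)) (nrm (z (n + 1) - w (n + 1))) (σ * a (n + 1)) hα0 hα2 hγ0 hγ1 hB
      (hnn _) (hr n) (by positivity)
    have i1 : (⟪S (n + 1), z (n + 1) - wstar⟫ : ℝ) = ⟪S n, z n - wstar⟫ +
        ⟪S n, z (n + 1) - z n⟫ + a (n + 1) * (⟪F (w (n + 1)), z (n + 1) - w (n + 1)⟫ +
        ⟪F (w (n + 1)), w (n + 1) - wstar⟫ - σ / γ * (⟪g (w (n + 1) - w 0), z (n + 1) - w (n + 1)⟫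
        - ⟪g (w (n + 1) - w 0), wstar - w (n + 1)⟫)) := by
      rw [hSS]
      simp only [inner_sub_left, inner_sub_right, inner_add_left, real_inner_smul_left]
      ring
    rw [hE, hE, i1, hAS]
    have haL : a (n + 1) * L = α * γ * (1 + σ * A n) := by rw [haS]; field_simp
    generalize hB' : 1 + σ * A n = B at *
    rw [show 1 + σ * (A n + a (n + 1)) = B + σ * a (n + 1) by rw [← hB']; ring]
    have f1 : B / 2 * nrm (z (n + 1) - z n) ^ 2 = B / γ * γ / 2 * nrm (z (n + 1) - z n) ^ 2 := by
      field_simp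
    have f2 := mul_le_mul_of_nonneg_left e2a hapos.le
    have f3 := mul_le_mul_of_nonneg_left e3 (show 0 ≤ a (n + 1) * (σ / γ) by positivity)
    have f4 := mul_le_mul_of_nonneg_left e4 (show 0 ≤ γ * B by positivity)
    have f5 := mul_le_mul_of_nonneg_left e5 hapos.le
    have f4a : γ * B * (1 / γ * γ / 2 * nrm (z (n + 1) - w (n + 1)) ^ 2) =
        B / 2 * (γ * nrm (z (n + 1) - w (n + 1)) ^ 2) := by field_simp
    have f4b : γ * B * (α / L * ⟪F (w n), z (n + 1) - w (n + 1)⟫ +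
        1 / γ / 2 * nrm (z (n + 1) - z n) ^ 2 - 1 / γ / 2 * nrm (w (n + 1) - z n) ^ 2) =
        a (n + 1) * ⟪F (w n), z (n + 1) - w (n + 1)⟫ +
        B / 2 * nrm (z (n + 1) - z n) ^ 2 - B / 2 * nrm (w (n + 1) - z n) ^ 2 := by
      rw [haS, hB']; field_simp
    rw [f4a, f4b] at f4
    have f5a : a (n + 1) * -(L * nrm (w (n + 1) - w n) * nrm (z (n + 1) - w (n + 1))) =
      - (α * γ * B * (nrm (w (n + 1) - w n) * nrm (z (n + 1) - w (n + 1)))) := by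
      rw [← haL]; ring
    rw [f5a] at f5
    have f3a : a (n + 1) * (σ / γ) * (γ / 2 * nrm (z (n + 1) - w (n + 1)) ^ 2) =
      σ * a (n + 1) / 2 * nrm (z (n + 1) - w (n + 1)) ^ 2 := by field_simp
    rw [mul_add, f3a] at f3
    have f6 : (B + σ * a (n + 1)) / γ / 2 * nrm (z (n + 1) - w 0) ^ 2 =
      B / γ / 2 * nrm (z (n + 1) - w 0) ^ 2 +
        a (n + 1) * (σ / γ) * (nrm (z (n + 1) - w 0) ^ 2 / 2) := by ring
    have f7 : σ * (A n + a (n + 1)) / γ / 2 * nrm (wstar - w 0) ^ 2 =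
      σ * A n / γ / 2 * nrm (wstar - w 0) ^ 2 +
        a (n + 1) * (σ / γ) * (nrm (wstar - w 0) ^ 2 / 2) := by ring
    rw [f6, f7]
    linarith
  have hE0 : E 0 = 0 := by rw [hE, hS0, hz0, hA0]; simp [hN0]
  have hlow : ∀ n, (1 + σ * A n) * γ / 4 * nrm (z n - w n) ^ 2 ≤ E n := by
    intro n
    induction n with
    | zero => rw [hE0, hz0]; simp [hN0]
    | succ n ih =>
      have h1 := hstep n
      have hB := hBpos n
      have h2 : 0 ≤ 7 / 16 * (1 + σ * A n) * nrm (w (n + 1) - z n) ^ 2 := by positivity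
      have h3 : 0 ≤ (1 + σ * A n) * γ * nrm (z n - w n) ^ 2 := by positivity
      linarith
  have hup : ∀ n, E n ≤ 1 / γ / 2 * nrm (wstar - w 0) ^ 2 := by
    intro n
    have h1 := isMinOn_iff.1 (hzmin n) wstar hwsW
    rw [hE, inner_sub_right]
    have : (1 + σ * A n) / γ / 2 * nrm (wstar - w 0) ^ 2 = 1 / γ / 2 * nrm (wstar - w 0) ^ 2 +
      σ * A n / γ / 2 * nrm (wstar - w 0) ^ 2 := by ring
    linarith
  obtain ⟨n, rfl⟩ : ∃ n, K = n + 1 := ⟨K - 1, by omega⟩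
  simp only [Nat.add_sub_cancel]
  intro v hv hvD
  have hB := hBpos n
  -- lower bound for the step size
  obtain ⟨b, hb0, hbB, hab⟩ : ∃ b, 0 < b ∧ b ≤ 1 + σ * A n ∧ a n = α * γ * b / L := by
    rcases n with _ | n
    · exact ⟨1 + σ * A 0, hB, le_rfl, by rw [ha0, haS 0]⟩
    · refine ⟨1 + σ * A n, hBpos n, ?_, haS n⟩
      have hapos : 0 < a (n + 1) := by have := hBpos n; rw [haS]; positivity
      rw [hAS]
      nlinarith
  have hpq : (1 + σ * A n) * (nrm (w (n + 1) - z n) ^ 2 + nrm (z n - w n) ^ 2) * γ ^ 2 ≤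
      8 / 3 * nrm (w 0 - wstar) ^ 2 := by
    have h1 := hstep n
    have h2 := hlow n
    have h3 := hup (n + 1)
    have hB' := hBpos (n + 1)
    have h4 : 0 ≤ (1 + σ * A (n + 1)) * γ / 4 * nrm (z (n + 1) - w (n + 1)) ^ 2 := by positivity
    have h5 : (1 + σ * A n) * γ * nrm (w (n + 1) - z n) ^ 2 ≤
      (1 + σ * A n) * 1 * nrm (w (n + 1) - z n) ^ 2 := by gcongr
    have h5' : 0 ≤ (1 + σ * A n) * nrm (w (n + 1) - z n) ^ 2 := by positivity
    have h6 : (1 + σ * A n) * (nrm (w (n + 1) - z n) ^ 2 + nrm (z n - w n) ^ 2) * γ * (3 / 16) ≤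
      1 / γ / 2 * nrm (w 0 - wstar) ^ 2 := by
      rw [hneg (w 0) wstar]
      linarith
    have h7 := mul_le_mul_of_nonneg_left h6 hγ0.le
    have h8 : γ * (1 / γ / 2 * nrm (w 0 - wstar) ^ 2) = nrm (w 0 - wstar) ^ 2 / 2 := by field_simp
    rw [h8] at h7
    linarith
  -- bound on the two residuals
  have hfin : ∀ t, 0 ≤ t → t ^ 2 ≤ 2 * (nrm (w (n + 1) - z n) ^ 2 + nrm (z n - w n) ^ 2) →
      L * t ≤ Real.sqrt (8 * α / γ) * nrm (w 0 - wstar) * Real.sqrt (L / a n) := by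
    intro t ht htt
    have hapos : 0 < a n := by rw [hab]; positivity
    refine abs_le_of_sq_le_sq' ?_ (by have := hnn (w 0 - wstar); positivity) |>.2
    rw [mul_pow, mul_pow, mul_pow, Real.sq_sqrt (by positivity), Real.sq_sqrt (by positivity), hab]
    have h1 : 8 * α / γ * nrm (w 0 - wstar) ^ 2 * (L / (α * γ * b / L)) =
      L ^ 2 * (8 * nrm (w 0 - wstar) ^ 2 / (γ ^ 2 * b)) := by field_simp
    rw [h1]
    refine mul_le_mul_of_nonneg_left ?_ (by positivity)
    rw [le_div_iff₀ (by positivity)]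
    calc t ^ 2 * (γ ^ 2 * b) ≤ (2 * (nrm (w (n + 1) - z n) ^ 2 + nrm (z n - w n) ^ 2)) *
          (γ ^ 2 * (1 + σ * A n)) := by gcongr
      _ ≤ 8 * nrm (w 0 - wstar) ^ 2 := by nlinarith [sq_nonneg (nrm (w 0 - wstar))]
  have hfp := hfin (nrm (w (n + 1) - z n)) (hnn _)
    (by nlinarith [sq_nonneg (nrm (w (n + 1) - z n)), sq_nonneg (nrm (z n - w n))])
  have hfr := hfin (nrm (w (n + 1) - w n)) (hnn _)
    (by nlinarith [hr n, hnn (w (n + 1) - w n), sq_nonneg (nrm (w (n + 1) - z n) - nrm (z n - w n))])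
  generalize hM : Real.sqrt (8 * α / γ) * nrm (w 0 - wstar) * Real.sqrt (L / a n) = M at *
  have hfo := optde_first_order W hWcv nrm g hgrad _ _ _ _ (hwW (n + 1)) (hwmin n) v hv
  rw [real_inner_smul_left] at hfo
  have hg1 : (⟪g (w (n + 1) - z n), v - w (n + 1)⟫ : ℝ) ≤ δ * nrm (w (n + 1) - z n) * D := by
    have h1 := hdual (v - w (n + 1)) (g (w (n + 1) - z n))
    have h2 := mul_le_mul_of_nonneg_right (hgbound (w (n + 1) - z n)) (hnn (v - w (n + 1)))
    have h3 : δ * nrm (w (n + 1) - z n) * nrm (v - w (n + 1)) ≤ δ * nrm (w (n + 1) - z n) * D := by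
      rw [hneg v]
      have := hnn (w (n + 1) - z n)
      gcongr
    linarith
  have hF1 : (⟪F (w (n + 1)) - F (w n), w (n + 1) - v⟫ : ℝ) ≤ M * D := by
    have h1 := hdual (w (n + 1) - v) (F (w (n + 1)) - F (w n))
    have h2 := mul_le_mul_of_nonneg_right (hLip _ (hwW (n + 1)) _ (hwW n)) (hnn (w (n + 1) - v))
    have h3 : L * nrm (w (n + 1) - w n) * nrm (w (n + 1) - v) ≤ M * D := by
      have := hnn (w (n + 1) - w n)
      have := hnn (w (n + 1) - v)
      have h0 : 0 ≤ L * nrm (w (n + 1) - w n) := by positivity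
      exact mul_le_mul hfr hvD this (h0.trans hfr)
    linarith
  have hF0 : (⟪F (w n), w (n + 1) - v⟫ : ℝ) ≤ δ / (α * γ) * (M * D) := by
    have h1 : (⟪F (w n), w (n + 1) - v⟫ : ℝ) = - ⟪F (w n), v - w (n + 1)⟫ := by
      rw [← inner_neg_right, neg_sub]
    have h2 := mul_le_mul_of_nonneg_left hfo (show 0 ≤ L / α by positivity)
    have h3 : L / α * (α / L * ⟪F (w n), v - w (n + 1)⟫ +
        1 / γ * ⟪g (w (n + 1) - z n), v - w (n + 1)⟫) = ⟪F (w n), v - w (n + 1)⟫ +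
        L / (α * γ) * ⟪g (w (n + 1) - z n), v - w (n + 1)⟫ := by field_simp
    rw [h3] at h2
    have h4 := mul_le_mul_of_nonneg_left hg1 (show 0 ≤ L / (α * γ) by positivity)
    have h5 : L / (α * γ) * (δ * nrm (w (n + 1) - z n) * D) =
      δ / (α * γ) * ((L * nrm (w (n + 1) - z n)) * D) := by ring
    have h6 : δ / (α * γ) * ((L * nrm (w (n + 1) - z n)) * D) ≤ δ / (α * γ) * (M * D) := by gcongr
    linarith
  have hgoal : (1 + δ / (α * γ)) * Real.sqrt (8 * α / γ) * D * nrm (w 0 - wstar) *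
      Real.sqrt (L / a n) = M * D + δ / (α * γ) * (M * D) := by rw [← hM]; ring
  rw [hgoal]
  rw [inner_sub_left] at hF1
  linarith
end

section
/- Proposition 1, last-iterate distance bound: Suppose Assumptions 1, 2 and 4 hold with parameter σ > 0, and run the OptDE algorithm with this σ. Then for every K ≥ 1 the last iterate w_K satisfies ‖w_K − w*‖ ≤ (C_0/σ) ‖w_0 − w*‖ √(L / a_{K−1}), where C_0 = (1 + δ/(αγ)) √(8α/γ), a_k = (αγ/L)(1 + αγσ/L)^{k−1} for k ≥ 1, a_0 := a_1, and w* is the σ-weak solution from Assumption 4. -/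
open scoped RealInnerProductSpace
open Finset MeasureTheory

lemma od_neg {d : ℕ} {nrm : Vec d → ℝ}
    (hsm : ∀ (c : ℝ) (x : Vec d), nrm (c • x) = |c| * nrm x) (x y : Vec d) :
    nrm (x - y) = nrm (y - x) := by
  have := hsm (-1) (y - x)
  simpa using this

lemma od_zero {d : ℕ} {nrm : Vec d → ℝ}
    (hsm : ∀ (c : ℝ) (x : Vec d), nrm (c • x) = |c| * nrm x) : nrm 0 = 0 := by
  have := hsm 0 0
  simpa using this

lemma od_nonneg {d : ℕ} {nrm : Vec d → ℝ}
    (hpos : ∀ x : Vec d, x ≠ 0 → 0 < nrm x)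
    (hsm : ∀ (c : ℝ) (x : Vec d), nrm (c • x) = |c| * nrm x) (x : Vec d) : 0 ≤ nrm x := by
  by_cases h : x = 0
  · rw [h, od_zero hsm]
  · exact (hpos x h).le

lemma od_holder {d : ℕ} {nrm : Vec d → ℝ} {g : Vec d → Vec d}
    (hpos : ∀ x : Vec d, x ≠ 0 → 0 < nrm x)
    (hsm : ∀ (c : ℝ) (x : Vec d), nrm (c • x) = |c| * nrm x)
    (hgrad : ∀ x : Vec d, HasGradientAt (fun v : Vec d => nrm v ^ 2 / 2) (g x) x)
    (x y : Vec d) : (⟪y, x⟫ : ℝ) ≤ dualNorm nrm y * nrm x := by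
  have hcont : Continuous (fun v : Vec d => nrm v ^ 2 / 2) :=
    continuous_iff_continuousAt.2 fun x => (hgrad x).hasFDerivAt.continuousAt
  obtain ⟨c, hc0, hc⟩ := (isCompact_sphere (0 : Vec d) 1).exists_forall_le'
    (a := 0) hcont.continuousOn (by
      intro b hb
      have hb0 : b ≠ 0 := by
        rintro rfl
        simp at hb
      have := hpos b hb0
      positivity)
  have hlow : ∀ u : Vec d, c * ‖u‖ ^ 2 ≤ nrm u ^ 2 / 2 := by
    intro u
    by_cases hu : u = 0
    · subst hu
      simp [od_zero hsm]
    · have hn : 0 < ‖u‖ := norm_pos_iff.2 hu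
      have h1 := hc (‖u‖⁻¹ • u) (by simp [norm_smul, hn.ne'])
      simp only [hsm, abs_inv, abs_norm] at h1
      have h2 := mul_le_mul_of_nonneg_right h1 (sq_nonneg ‖u‖)
      have h3 : (‖u‖⁻¹ * nrm u) ^ 2 / 2 * ‖u‖ ^ 2 = nrm u ^ 2 / 2 := by
        field_simp
      linarith
  have hbdd : BddAbove ((fun x => (⟪x, y⟫ : ℝ)) '' {x | nrm x ≤ 1}) := by
    refine ⟨(1 / (2 * c) + 1) * ‖y‖, ?_⟩
    rintro _ ⟨u, hu, rfl⟩
    have hu1 : nrm u ≤ 1 := hu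
    have hu0 := od_nonneg hpos hsm u
    have h1 := hlow u
    have h2 : ‖u‖ ^ 2 ≤ 1 / (2 * c) := by
      rw [le_div_iff₀ (by positivity)]
      nlinarith
    have h3 : ‖u‖ ≤ 1 / (2 * c) + 1 := by nlinarith [norm_nonneg u]
    exact (real_inner_le_norm u y).trans (mul_le_mul_of_nonneg_right h3 (norm_nonneg y))
  by_cases hx : x = 0
  · subst hx
    simp [od_zero hsm]
  · have hn := hpos x hx
    have h1 : (⟪(nrm x)⁻¹ • x, y⟫ : ℝ) ≤ dualNorm nrm y := by
      apply le_csSup hbdd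
      refine ⟨(nrm x)⁻¹ • x, ?_, rfl⟩
      simp [hsm, abs_of_pos hn, hn.ne']
    rw [real_inner_smul_left, real_inner_comm, inv_mul_le_iff₀ hn] at h1
    linarith

lemma od_foc {d : ℕ} {W : Set (Vec d)} (hW : Convex ℝ W) {nrm : Vec d → ℝ} {g : Vec d → Vec d}
    (hgrad : ∀ x : Vec d, HasGradientAt (fun v : Vec d => nrm v ^ 2 / 2) (g x) x)
    (s p m : Vec d) (c : ℝ) (hm : m ∈ W)
    (hmin : IsMinOn (fun x => (⟪s, x⟫ : ℝ) + c * nrm (x - p) ^ 2) W m)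
    (x : Vec d) (hx : x ∈ W) : 0 ≤ (⟪s, x - m⟫ : ℝ) + 2 * c * ⟪g (m - p), x - m⟫ := by
  have h1 : HasFDerivAt (fun x : Vec d => nrm (x - p) ^ 2 / 2)
      (InnerProductSpace.toDual ℝ _ (g (m - p))) m := by
    have h0 := (hgrad (m - p)).hasFDerivAt
    have := h0.comp m ((hasFDerivAt_id m).sub_const p)
    simpa [Function.comp_def] using this
  have h2 : HasFDerivAt (fun x : Vec d => (⟪s, x⟫ : ℝ)) (innerSL ℝ s) m :=
    (innerSL ℝ s).hasFDerivAt
  have h3 := h2.add (h1.const_mul (2 * c))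
  have h4 : IsLocalMinOn ((fun x : Vec d => (⟪s, x⟫ : ℝ)) +
      fun x => 2 * c * (nrm (x - p) ^ 2 / 2)) W m := by
    apply IsMinOn.localize
    intro u hu
    have := hmin hu
    simp only [Set.mem_ofPred_eq, Pi.add_apply] at this ⊢
    linarith
  have h5 := h4.hasFDerivWithinAt_nonneg h3.hasFDerivWithinAt
    (sub_mem_posTangentConeAt_of_segment_subset (hW.segment_subset hm hx))
  simpa using h5

lemma od_strong {d : ℕ} {W : Set (Vec d)} (hW : Convex ℝ W) {nrm : Vec d → ℝ} {g : Vec d → Vec d}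
    {γ : ℝ}
    (hgrad : ∀ x : Vec d, HasGradientAt (fun v : Vec d => nrm v ^ 2 / 2) (g x) x)
    (hstrong : ∀ v x : Vec d,
      nrm v ^ 2 / 2 + ⟪g v, x - v⟫ + γ / 2 * nrm (x - v) ^ 2 ≤ nrm x ^ 2 / 2)
    (s p m : Vec d) (c : ℝ) (hc : 0 ≤ c) (hm : m ∈ W)
    (hmin : IsMinOn (fun x => (⟪s, x⟫ : ℝ) + c * nrm (x - p) ^ 2) W m)
    (x : Vec d) (hx : x ∈ W) :
    (⟪s, m⟫ : ℝ) + c * nrm (m - p) ^ 2 + c * γ * nrm (x - m) ^ 2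
      ≤ (⟪s, x⟫ : ℝ) + c * nrm (x - p) ^ 2 := by
  have h1 := od_foc hW hgrad s p m c hm hmin x hx
  have h2 := hstrong (m - p) (x - p)
  rw [sub_sub_sub_cancel_right] at h2
  have h3 := mul_le_mul_of_nonneg_left h2 (by linarith : 0 ≤ 2 * c)
  rw [inner_sub_right] at h1
  linarith

/-- The estimate function. -/
noncomputable def odPsi {d : ℕ} (F : Vec d → Vec d) (nrm : Vec d → ℝ) (g : Vec d → Vec d)
    (γ σ : ℝ) (a : ℕ → ℝ) (w : ℕ → Vec d) (k : ℕ) (x : Vec d) : ℝ :=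
  ∑ i ∈ Finset.Icc 1 k, a i * ((⟪F (w i), x - w i⟫ : ℝ) +
    σ / γ * breg nrm g (w i - w 0) (x - w 0)) + 1 / (2 * γ) * nrm (x - w 0) ^ 2

lemma od_psi_eq {d : ℕ} (F : Vec d → Vec d) (nrm : Vec d → ℝ) (g : Vec d → Vec d)
    (γ σ : ℝ) (hγ : 0 < γ) (a A : ℕ → ℝ) (w : ℕ → Vec d) (hA0 : A 0 = 0)
    (hArec : ∀ k, 1 ≤ k → A k = A (k - 1) + a k) (k : ℕ) :
    ∃ c : ℝ, ∀ x, odPsi F nrm g γ σ a w k x =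
      (⟪∑ i ∈ Finset.Icc 1 k, a i • (F (w i) - (σ / γ) • g (w i - w 0)), x⟫ : ℝ) +
        (1 + σ * A k) / (2 * γ) * nrm (x - w 0) ^ 2 + c := by
  induction k with
  | zero => exact ⟨0, fun x => by simp [odPsi, hA0]⟩
  | succ k ih =>
    obtain ⟨c, hc⟩ := ih
    refine ⟨c + a (k+1) * (-⟪F (w (k+1)), w (k+1)⟫ + σ / γ * (- (nrm (w (k+1) - w 0) ^ 2 / 2)
      + ⟪g (w (k+1) - w 0), w (k+1)⟫)), fun x => ?_⟩
    have h := hc x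
    unfold odPsi at h ⊢
    rw [Finset.sum_Icc_succ_top (by omega), Finset.sum_Icc_succ_top (by omega),
      hArec (k+1) (by omega), inner_add_left, Nat.add_sub_cancel]
    unfold breg at h ⊢
    rw [sub_sub_sub_cancel_right, real_inner_smul_left, inner_sub_left, real_inner_smul_left,
      inner_sub_right, inner_sub_right]
    have e : (1 + σ * (A k + a (k+1))) / (2 * γ) * nrm (x - w 0) ^ 2 =
      (1 + σ * A k) / (2 * γ) * nrm (x - w 0) ^ 2
        + a (k+1) * (σ / γ * (nrm (x - w 0) ^ 2 / 2)) := by field_simp; ring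
    rw [e]
    linarith

set_option maxHeartbeats 2000000 in
theorem optde_last_iterate_distance_bound
    {d : ℕ} (W : Set (Vec d)) (hWne : W.Nonempty) (hWcl : IsClosed W) (hWcv : Convex ℝ W)
    (F : Vec d → Vec d) (nrm : Vec d → ℝ) (g : Vec d → Vec d)
    (L γ δ α σ : ℝ)
    -- `nrm` is a norm on ℝ^d
    (hnrm_pos : ∀ x : Vec d, x ≠ 0 → 0 < nrm x)
    (hnrm_add : ∀ x y : Vec d, nrm (x + y) ≤ nrm x + nrm y)
    (hnrm_smul : ∀ (c : ℝ) (x : Vec d), nrm (c • x) = |c| * nrm x)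
    (hL : 0 < L) (hγ0 : 0 < γ) (hγ1 : γ ≤ 1) (hδ : 0 < δ) (hσ : 0 < σ)
    -- Assumption 1
    (hLip : ∀ v ∈ W, ∀ u ∈ W, dualNorm nrm (F v - F u) ≤ L * nrm (v - u))
    -- Assumption 2
    (hgrad : ∀ x : Vec d, HasGradientAt (fun v : Vec d => nrm v ^ 2 / 2) (g x) x)
    (hstrong : ∀ v x : Vec d,
      nrm v ^ 2 / 2 + ⟪g v, x - v⟫ + γ / 2 * nrm (x - v) ^ 2 ≤ nrm x ^ 2 / 2)
    (hgbound : ∀ x : Vec d, dualNorm nrm (g x) ≤ δ * nrm x)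
    -- OptDE algorithm with parameter σ
    (hα0 : 0 < α)
    (hαle : α ≤ min (1 / (4 * Real.sqrt 2)) (Real.sqrt 3 / (4 * Real.sqrt γ)))
    (a A : ℕ → ℝ) (hA0 : A 0 = 0)
    (ha : ∀ k, 1 ≤ k → a k = α * γ * (1 + σ * A (k - 1)) / L)
    (ha0 : a 0 = a 1)
    (hArec : ∀ k, 1 ≤ k → A k = A (k - 1) + a k)
    (w z : ℕ → Vec d) (hw0W : w 0 ∈ W) (hz0 : z 0 = w 0)
    -- Assumption 4: existence of a σ-weak solution w* (w.r.t. the center w 0)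
    (wstar : Vec d) (hwsW : wstar ∈ W)
    (hsweak : ∀ v ∈ W,
      σ / γ * (breg nrm g (v - w 0) (wstar - w 0) + breg nrm g (wstar - w 0) (v - w 0)) ≤
        (⟪F v, v - wstar⟫ : ℝ))
    -- extrapolation step
    (hwk : ∀ k, 1 ≤ k → w k ∈ W ∧
      IsMinOn (fun x => (⟪(α / L) • F (w (k - 1)), x⟫ : ℝ) +
        1 / (2 * γ) * nrm (x - z (k - 1)) ^ 2) W (w k))
    -- dual averaging step
    (hzk : ∀ k, 1 ≤ k → z k ∈ W ∧
      IsMinOn (fun x =>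
        (⟪∑ i ∈ Finset.Icc 1 k, a i • (F (w i) - (σ / γ) • g (w i - w 0)), x⟫ : ℝ) +
        (1 + σ * A k) / (2 * γ) * nrm (x - w 0) ^ 2) W (z k))
    (K : ℕ) (hK : 1 ≤ K)
    :
    nrm (w K - wstar) ≤
      ((1 + δ / (α * γ)) * Real.sqrt (8 * α / γ) / σ) * nrm (w 0 - wstar) *
        Real.sqrt (L / a (K - 1)) := by
  have hsum : α ≤ 1 / (4 * Real.sqrt 2) := hαle.trans (min_le_left _ _)
  have hα2 : α ^ 2 ≤ 1 / 32 := by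
    have h2 : (1 / (4 * Real.sqrt 2)) ^ 2 = (1 / 32 : ℝ) := by
      rw [div_pow, mul_pow, Real.sq_sqrt (by norm_num)]; norm_num
    rw [← h2]
    exact pow_le_pow_left₀ hα0.le hsum 2
  have hn0 : ∀ x, 0 ≤ nrm x := od_nonneg hnrm_pos hnrm_smul
  have hsymm := od_neg hnrm_smul
  have hhol : ∀ x y : Vec d, (⟪y, x⟫ : ℝ) ≤ dualNorm nrm y * nrm x :=
    od_holder hnrm_pos hnrm_smul hgrad
  have hbreg : ∀ v x, γ / 2 * nrm (x - v) ^ 2 ≤ breg nrm g v x := by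
    intro v x
    have := hstrong v x
    unfold breg
    linarith
  have hwW : ∀ k, w k ∈ W := by
    intro k
    rcases Nat.eq_zero_or_pos k with rfl | h
    · exact hw0W
    · exact (hwk k h).1
  have hzW : ∀ k, z k ∈ W := by
    intro k
    rcases Nat.eq_zero_or_pos k with rfl | h
    · exact hz0 ▸ hw0W
    · exact (hzk k h).1
  have hA : ∀ k, 0 ≤ A k := by
    intro k
    induction k with
    | zero => exact hA0.ge
    | succ k ih =>
      rw [hArec (k+1) (by omega), ha (k+1) (by omega), Nat.add_sub_cancel]
      positivity
  have haS : ∀ k, a (k+1) = α * γ * (1 + σ * A k) / L := fun k => ha (k+1) (by omega)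
  have hAS : ∀ k, A (k+1) = A k + a (k+1) := fun k => hArec (k+1) (by omega)
  have haSpos : ∀ k, 0 < a (k+1) := by
    intro k
    rw [haS]
    have := hA k
    positivity
  let ψ := odPsi F nrm g γ σ a w
  have hψS : ∀ k x, ψ (k+1) x = ψ k x + a (k+1) * ((⟪F (w (k+1)), x - w (k+1)⟫ : ℝ) +
      σ / γ * breg nrm g (w (k+1) - w 0) (x - w 0)) := by
    intro k x
    simp only [ψ, odPsi]
    rw [Finset.sum_Icc_succ_top (by omega)]
    ring
  have hψ0 : ∀ x, ψ 0 x = 1 / (2 * γ) * nrm (x - w 0) ^ 2 := by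
    intro x
    simp [ψ, odPsi]
  have hψmin : ∀ k, ∀ x ∈ W, ψ k (z k) + (1 + σ * A k) / 2 * nrm (x - z k) ^ 2 ≤ ψ k x := by
    intro k x hx
    rcases Nat.eq_zero_or_pos k with rfl | h
    · rw [hψ0, hψ0, hz0, hA0, sub_self, od_zero hnrm_smul]
      have h1 : (1:ℝ) / 2 ≤ 1 / (2 * γ) := by
        apply one_div_le_one_div_of_le <;> linarith
      have := mul_le_mul_of_nonneg_right h1 (sq_nonneg (nrm (x - w 0)))
      linarith
    · obtain ⟨c, hc⟩ := od_psi_eq F nrm g γ σ hγ0 a A w hA0 hArec k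
      have h0 := hA k
      have h1 := od_strong hWcv hgrad hstrong _ (w 0) (z k) ((1 + σ * A k) / (2 * γ))
        (by positivity) (hzW k) (hzk k h).2 x hx
      have h2 : (1 + σ * A k) / (2 * γ) * γ = (1 + σ * A k) / 2 := by field_simp
      rw [h2] at h1
      simp only [ψ, hc]
      linarith
  have hψup : ∀ k, ψ k wstar ≤ 1 / (2 * γ) * nrm (w 0 - wstar) ^ 2 := by
    intro k
    induction k with
    | zero => rw [hψ0, hsymm]
    | succ k ih =>
      rw [hψS]
      have h1 := hsweak _ (hwW (k+1))
      have h2 := hbreg (wstar - w 0) (w (k+1) - w 0)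
      have h3 : 0 ≤ σ / γ * breg nrm g (wstar - w 0) (w (k+1) - w 0) := by
        have : 0 ≤ breg nrm g (wstar - w 0) (w (k+1) - w 0) :=
          le_trans (by positivity) h2
        positivity
      have h4 : (⟪F (w (k+1)), wstar - w (k+1)⟫ : ℝ) = - ⟪F (w (k+1)), w (k+1) - wstar⟫ := by
        rw [← inner_neg_right, neg_sub]
      have h5 : (⟪F (w (k+1)), wstar - w (k+1)⟫ : ℝ) +
        σ / γ * breg nrm g (w (k+1) - w 0) (wstar - w 0) ≤ 0 := by
        rw [h4]; linarith
      have := mul_nonpos_of_nonneg_of_nonpos (haSpos k).le h5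
      linarith
  have hψz : ∀ k, ψ k (z k) ≤ 1 / (2 * γ) * nrm (w 0 - wstar) ^ 2 := by
    intro k
    have h1 := hψmin k wstar hwsW
    have h2 := hA k
    have h3 : 0 ≤ (1 + σ * A k) / 2 * nrm (wstar - z k) ^ 2 := by positivity
    linarith [hψup k]
  have hstep : ∀ k, ψ k (z k) + (1 + σ * A k) * (7 / 16 * nrm (w (k+1) - z k) ^ 2
      - γ / 16 * nrm (z k - w k) ^ 2)
      + γ / 4 * (1 + σ * A (k+1)) * nrm (z (k+1) - w (k+1)) ^ 2 ≤ ψ (k+1) (z (k+1)) := by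
    intro k
    have hB : 0 < 1 + σ * A k := by have := hA k; positivity
    have h1 := hψmin k (z (k+1)) (hzW _)
    rw [hψS]
    have h2 := hbreg (w (k+1) - w 0) (z (k+1) - w 0)
    rw [sub_sub_sub_cancel_right] at h2
    have h2' := mul_le_mul_of_nonneg_left h2 (by positivity : 0 ≤ σ / γ)
    have e2 : σ / γ * (γ / 2 * nrm (z (k+1) - w (k+1)) ^ 2)
      = σ / 2 * nrm (z (k+1) - w (k+1)) ^ 2 := by field_simp
    rw [e2] at h2'
    have h2'' := mul_le_mul_of_nonneg_left h2' (haSpos k).le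
    have h3 := od_strong hWcv hgrad hstrong _ (z k) (w (k+1)) (1 / (2 * γ))
        (by positivity) (hwW (k+1)) (hwk (k+1) (by omega)).2 (z (k+1)) (hzW _)
    rw [Nat.add_sub_cancel, real_inner_smul_left, real_inner_smul_left] at h3
    have h3' := mul_le_mul_of_nonneg_left h3 (mul_pos hγ0 hB).le
    have h4 : (⟪F (w k) - F (w (k+1)), z (k+1) - w (k+1)⟫ : ℝ) ≤
        L * nrm (w (k+1) - w k) * nrm (z (k+1) - w (k+1)) := by
      refine (hhol _ _).trans (mul_le_mul_of_nonneg_right ?_ (hn0 _))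
      rw [hsymm (w (k+1))]
      exact hLip _ (hwW _) _ (hwW _)
    have h4' := mul_le_mul_of_nonneg_left h4 (haSpos k).le
    have h5 : nrm (w (k+1) - w k) ≤ nrm (w (k+1) - z k) + nrm (z k - w k) := by
      have := hnrm_add (w (k+1) - z k) (z k - w k)
      simpa using this
    rw [inner_sub_left, inner_sub_right, inner_sub_right] at h4'
    rw [inner_sub_right]
    rw [hAS]
    have h3'' : a (k+1) * (⟪F (w k), w (k+1)⟫ : ℝ) + (1 + σ * A k) / 2 * nrm (w (k+1) - z k) ^ 2
        + γ * (1 + σ * A k) / 2 * nrm (z (k+1) - w (k+1)) ^ 2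
        ≤ a (k+1) * (⟪F (w k), z (k+1)⟫ : ℝ) + (1 + σ * A k) / 2 * nrm (z (k+1) - z k) ^ 2 := by
      rw [haS]
      have e1 : ∀ P Q R : ℝ, γ * (1 + σ * A k) * (α / L * P + 1 / (2 * γ) * Q + 1 / (2 * γ) * γ * R)
          = α * γ * (1 + σ * A k) / L * P + (1 + σ * A k) / 2 * Q + γ * (1 + σ * A k) / 2 * R := by
        intro P Q R; field_simp
      have e2 : ∀ P Q : ℝ, γ * (1 + σ * A k) * (α / L * P + 1 / (2 * γ) * Q)
          = α * γ * (1 + σ * A k) / L * P + (1 + σ * A k) / 2 * Q := by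
        intro P Q; field_simp
      rw [e1, e2] at h3'
      exact h3'
    have h6 : a (k+1) * (L * nrm (w (k+1) - w k) * nrm (z (k+1) - w (k+1))) ≤
        γ * (1 + σ * A k) * (1 / 16 * nrm (w (k+1) - z k) ^ 2 + 1 / 16 * nrm (z k - w k) ^ 2
          + 1 / 4 * nrm (z (k+1) - w (k+1)) ^ 2) := by
      have e : a (k+1) * (L * nrm (w (k+1) - w k) * nrm (z (k+1) - w (k+1))) =
        γ * (1 + σ * A k) * (α * nrm (w (k+1) - w k) * nrm (z (k+1) - w (k+1))) := by
        rw [haS]; field_simp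
      rw [e]
      refine mul_le_mul_of_nonneg_left ?_ (mul_pos hγ0 hB).le
      have y1 : α * nrm (w (k+1) - w k) * nrm (z (k+1) - w (k+1)) ≤
          α ^ 2 * nrm (w (k+1) - w k) ^ 2 + 1 / 4 * nrm (z (k+1) - w (k+1)) ^ 2 := by
        nlinarith [sq_nonneg (α * nrm (w (k+1) - w k) - 1 / 2 * nrm (z (k+1) - w (k+1)))]
      have y2 := mul_le_mul_of_nonneg_right hα2 (sq_nonneg (nrm (w (k+1) - w k)))
      have y3 := pow_le_pow_left₀ (hn0 _) h5 2
      have y4 := sq_nonneg (nrm (w (k+1) - z k) - nrm (z k - w k))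
      linarith
    have h7 : γ * ((1 + σ * A k) * nrm (w (k+1) - z k) ^ 2) ≤
        (1 + σ * A k) * nrm (w (k+1) - z k) ^ 2 :=
      mul_le_of_le_one_left (by positivity) hγ1
    have h8 : γ * (a (k+1) * σ * nrm (z (k+1) - w (k+1)) ^ 2) ≤
        a (k+1) * σ * nrm (z (k+1) - w (k+1)) ^ 2 := by
      have := haSpos k
      exact mul_le_of_le_one_left (by positivity) hγ1
    have h9 : 0 ≤ a (k+1) * σ * nrm (z (k+1) - w (k+1)) ^ 2 := by
      have := haSpos k
      positivity
    linarith
  have hinv : ∀ k, γ / 4 * (1 + σ * A k) * nrm (z k - w k) ^ 2 ≤ ψ k (z k) := by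
    intro k
    induction k with
    | zero => rw [hψ0, hz0, sub_self, od_zero hnrm_smul]; simp
    | succ k ih =>
      have h1 := hstep k
      have hB : 0 < 1 + σ * A k := by have := hA k; positivity
      have h2 : 0 ≤ (1 + σ * A k) * (7 / 16 * nrm (w (k+1) - z k) ^ 2) := by positivity
      have h3 : 0 ≤ γ * (1 + σ * A k) * nrm (z k - w k) ^ 2 := by positivity
      linarith
  obtain ⟨k, rfl⟩ : ∃ k, K = k + 1 := ⟨K - 1, by omega⟩
  rw [Nat.add_sub_cancel]
  have hB : 0 < 1 + σ * A k := by have := hA k; positivity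
  have hak : 0 < a k ∧ a k ≤ a (k+1) := by
    rcases k with _ | j
    · rw [ha0]; exact ⟨haSpos 0, le_rfl⟩
    · refine ⟨haSpos j, ?_⟩
      rw [haS, haS]
      have := hAS j
      have := haSpos j
      gcongr
      linarith
  have hp2 : nrm (w (k+1) - z k) ^ 2 ≤ 8 / 7 * (nrm (w 0 - wstar) ^ 2 / (γ * (1 + σ * A k))) := by
    have h1 := hstep k
    have h2 := hinv k
    have h3 := hψz (k+1)
    have h4 : 0 ≤ γ * (1 + σ * A k) * nrm (z k - w k) ^ 2 := by positivity
    have h5 : 0 ≤ γ / 4 * (1 + σ * A (k+1)) * nrm (z (k+1) - w (k+1)) ^ 2 := by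
      have := hA (k+1)
      positivity
    have h6 : (1 + σ * A k) * (7 / 16 * nrm (w (k+1) - z k) ^ 2) ≤
      1 / (2 * γ) * nrm (w 0 - wstar) ^ 2 := by linarith
    have h7 := mul_le_mul_of_nonneg_left h6 (by positivity : 0 ≤ 16 / 7 / (1 + σ * A k))
    have e1 : ∀ P : ℝ, 16 / 7 / (1 + σ * A k) * ((1 + σ * A k) * (7 / 16 * P)) = P := by
      intro P; field_simp
    have e2 : ∀ P : ℝ, 16 / 7 / (1 + σ * A k) * (1 / (2 * γ) * P)
        = 8 / 7 * (P / (γ * (1 + σ * A k))) := by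
      intro P; field_simp; ring
    rw [e1, e2] at h7
    exact h7
  have hq2 : nrm (z k - w k) ^ 2 ≤ 2 / γ * (nrm (w 0 - wstar) ^ 2 / (γ * (1 + σ * A k))) := by
    have h6 := (hinv k).trans (hψz k)
    have h7 := mul_le_mul_of_nonneg_left h6 (by positivity : 0 ≤ 4 / γ / (1 + σ * A k))
    have e1 : ∀ P : ℝ, 4 / γ / (1 + σ * A k) * (γ / 4 * (1 + σ * A k) * P) = P := by
      intro P; field_simp
    have e2 : ∀ P : ℝ, 4 / γ / (1 + σ * A k) * (1 / (2 * γ) * P)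
        = 2 / γ * (P / (γ * (1 + σ * A k))) := by
      intro P; field_simp; ring
    rw [e1, e2] at h7
    exact h7
  -- the target radius
  set R := Real.sqrt (8 * α / γ) * nrm (w 0 - wstar) * Real.sqrt (L / a k) / L with hR
  have hR0 : 0 ≤ R := by have := hn0 (w 0 - wstar); positivity
  have hR2 : 8 / γ * (nrm (w 0 - wstar) ^ 2 / (γ * (1 + σ * A k))) ≤ R ^ 2 := by
    have e : R ^ 2 = 8 * α / γ * nrm (w 0 - wstar) ^ 2 * (L / a k) / L ^ 2 := by
      have := hak.1
      rw [hR, div_pow, mul_pow, mul_pow, Real.sq_sqrt (by positivity), Real.sq_sqrt (by positivity)]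
    have e2 : R ^ 2 = 8 / γ * nrm (w 0 - wstar) ^ 2 * (α / L) * (1 / a k) := by
      have := hak.1
      rw [e]; field_simp
    have e3 : 8 / γ * (nrm (w 0 - wstar) ^ 2 / (γ * (1 + σ * A k))) =
      8 / γ * nrm (w 0 - wstar) ^ 2 * (α / L) * (1 / a (k+1)) := by
      rw [haS]; field_simp
    rw [e2, e3]
    exact mul_le_mul_of_nonneg_left (one_div_le_one_div_of_le hak.1 hak.2) (by positivity)
  set D := nrm (w 0 - wstar) ^ 2 / (γ * (1 + σ * A k)) with hD
  have hD0 : 0 ≤ D := by positivity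
  have hγi : 1 ≤ 1 / γ := by rw [le_div_iff₀ hγ0]; linarith
  have hDγ : D ≤ 1 / γ * D := by nlinarith
  have hpR : nrm (w (k+1) - z k) ≤ R := by
    refine (pow_le_pow_iff_left₀ (hn0 _) hR0 two_ne_zero).1 ?_
    have : 8 / γ * D = 8 * (1 / γ * D) := by ring
    linarith
  have hwwR : nrm (w (k+1) - w k) ≤ R := by
    have h5 : nrm (w (k+1) - w k) ≤ nrm (w (k+1) - z k) + nrm (z k - w k) := by
      have := hnrm_add (w (k+1) - z k) (z k - w k)
      simpa using this
    refine h5.trans ((pow_le_pow_iff_left₀ (add_nonneg (hn0 _) (hn0 _)) hR0 two_ne_zero).1 ?_)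
    have e1 : 8 / γ * D = 8 * (1 / γ * D) := by ring
    have e2 : 2 / γ * D = 2 * (1 / γ * D) := by ring
    nlinarith [sq_nonneg (nrm (w (k+1) - z k) - nrm (z k - w k))]
  -- residual bound
  have hres : σ * nrm (w (k+1) - wstar) ^ 2 ≤
      (L * R + L * δ / (α * γ) * R) * nrm (w (k+1) - wstar) := by
    have h1 := hsweak _ (hwW (k+1))
    have b1 := hbreg (w (k+1) - w 0) (wstar - w 0)
    have b2 := hbreg (wstar - w 0) (w (k+1) - w 0)
    rw [sub_sub_sub_cancel_right] at b1 b2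
    rw [hsymm] at b1
    have b3 := mul_le_mul_of_nonneg_left (add_le_add b1 b2) (by positivity : 0 ≤ σ / γ)
    have e3 : σ / γ * (γ / 2 * nrm (w (k+1) - wstar) ^ 2 + γ / 2 * nrm (w (k+1) - wstar) ^ 2)
      = σ * nrm (w (k+1) - wstar) ^ 2 := by field_simp; ring
    rw [e3] at b3
    have f := od_foc hWcv hgrad _ (z k) (w (k+1)) (1 / (2 * γ)) (hwW _)
      (hwk (k+1) (by omega)).2 wstar hwsW
    rw [Nat.add_sub_cancel, real_inner_smul_left] at f
    have h4 : (⟪F (w (k+1)) - F (w k), w (k+1) - wstar⟫ : ℝ) ≤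
        L * R * nrm (w (k+1) - wstar) := by
      refine (hhol _ _).trans (mul_le_mul_of_nonneg_right ?_ (hn0 _))
      exact (hLip _ (hwW _) _ (hwW _)).trans (mul_le_mul_of_nonneg_left hwwR hL.le)
    have h5 : (⟪g (w (k+1) - z k), wstar - w (k+1)⟫ : ℝ) ≤
        δ * R * nrm (w (k+1) - wstar) := by
      refine (hhol _ _).trans ?_
      rw [hsymm wstar]
      refine mul_le_mul_of_nonneg_right ?_ (hn0 _)
      exact (hgbound _).trans (mul_le_mul_of_nonneg_left hpR hδ.le)
    have h6 : (⟪F (w k), wstar - w (k+1)⟫ : ℝ) = - ⟪F (w k), w (k+1) - wstar⟫ := by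
      rw [← inner_neg_right, neg_sub]
    rw [h6] at f
    rw [inner_sub_left] at h4
    have h7 := mul_le_mul_of_nonneg_left h5 (by positivity : 0 ≤ L / (α * γ))
    have h8 := mul_nonneg (by positivity : 0 ≤ L / α) f
    have e8 : L / α * (α / L * -(⟪F (w k), w (k+1) - wstar⟫ : ℝ) +
        2 * (1 / (2 * γ)) * ⟪g (w (k+1) - z k), wstar - w (k+1)⟫) =
        -(⟪F (w k), w (k+1) - wstar⟫ : ℝ) +
          L / (α * γ) * ⟪g (w (k+1) - z k), wstar - w (k+1)⟫ := by field_simp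
    rw [e8] at h8
    have e7 : L / (α * γ) * (δ * R * nrm (w (k+1) - wstar)) =
      L * δ / (α * γ) * R * nrm (w (k+1) - wstar) := by ring
    linarith
  have hfin : σ * nrm (w (k+1) - wstar) ≤ L * R + L * δ / (α * γ) * R := by
    rcases (hn0 (w (k+1) - wstar)).eq_or_lt with h | h
    · rw [← h]; simp; positivity
    · refine le_of_mul_le_mul_right ?_ h
      linarith
  have hRL : (1 + δ / (α * γ)) * Real.sqrt (8 * α / γ) / σ * nrm (w 0 - wstar) *
      Real.sqrt (L / a k) = (L * R + L * δ / (α * γ) * R) / σ := by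
    rw [hR]; field_simp
  rw [hRL, le_div_iff₀ hσ]
  linarith
end
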